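/- The only pairs (x, y) ∈ ℚ × ℚ satisfying y² = x⁶ + 2x⁵ + 5x⁴ + 8x³ + 12x² + 8x + 4 are (x, y) ∈ {(−1, 2), (−1, −2), (0, 2), (0, −2)}. -/

import Mathlib

namespace N3M3

abbrev ZI := GaussianInt
noncomputable section
def K := FractionRing ZI
instance : Field K := inferInstanceAs (Field (FractionRing ZI))
instance : Algebra ZI K := inferInstanceAs (Algebra ZI (FractionRing ZI))
instance : IsFractionRing ZI K := inferInstanceAs (IsFractionRing ZI (FractionRing ZI))
instance : CharZero K := charZero_of_injective_algebraMap (IsFractionRing.injective ZI K)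

def lam : ZI := ⟨1, 1⟩

theorem prime_of_norm_prime (z : ZI) (h : Nat.Prime z.norm.natAbs) : Prime z := by
  rw [← irreducible_iff_prime]
  constructor
  · intro hu
    have := Zsqrtd.norm_eq_one_iff.2 hu
    rw [this] at h
    exact Nat.not_prime_one h
  · intro a b hab
    have h1 : z.norm.natAbs = a.norm.natAbs * b.norm.natAbs := by
      rw [hab, Zsqrtd.norm_mul, Int.natAbs_mul]
    rw [h1] at h
    rcases Nat.prime_mul_iff.1 h with ⟨_, h2⟩ | ⟨_, h2⟩
    · right; exact Zsqrtd.norm_eq_one_iff.1 h2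
    · left; exact Zsqrtd.norm_eq_one_iff.1 h2

theorem prime_lam : Prime lam := prime_of_norm_prime _ (by norm_num [lam, Zsqrtd.norm])

def vl : IsDedekindDomain.HeightOneSpectrum ZI where
  asIdeal := Ideal.span {lam}
  isPrime := (Ideal.span_singleton_prime prime_lam.ne_zero).2 prime_lam
  ne_bot := by
    rw [Ne, Ideal.span_singleton_eq_bot]; exact prime_lam.ne_zero

open WithZero

/-- `z` has valuation at least `k`. -/
def D (k : ℤ) (z : K) : Prop := vl.valuation K z ≤ exp (-k)
/-- `z` has valuation exactly `k`. -/
def V (k : ℤ) (z : K) : Prop := vl.valuation K z = exp (-k)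

theorem D_zero (k : ℤ) : D k 0 := by simp [D]
theorem V.d {k : ℤ} {z : K} (h : V k z) : D k z := le_of_eq h
theorem D.mono {k l : ℤ} {z : K} (h : D k z) (hl : l ≤ k) : D l z :=
  le_trans h (by rw [exp_le_exp]; omega)
theorem D.add {k : ℤ} {a b : K} (ha : D k a) (hb : D k b) : D k (a + b) :=
  Valuation.map_add_le _ ha hb
theorem D.neg {k : ℤ} {a : K} (ha : D k a) : D k (-a) := by
  unfold D; rw [Valuation.map_neg]; exact ha
theorem D.sub {k : ℤ} {a b : K} (ha : D k a) (hb : D k b) : D k (a - b) := by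
  rw [sub_eq_add_neg]; exact ha.add hb.neg
theorem D.mul {k l : ℤ} {a b : K} (ha : D k a) (hb : D l b) : D (k + l) (a * b) := by
  unfold D at *
  rw [map_mul, neg_add, exp_add]
  exact mul_le_mul' ha hb
theorem V.mul {k l : ℤ} {a b : K} (ha : V k a) (hb : V l b) : V (k + l) (a * b) := by
  unfold V at *
  rw [map_mul, neg_add, exp_add, ha, hb]
theorem V.inv {k : ℤ} {a : K} (ha : V k a) : V (-k) a⁻¹ := by
  unfold V at *
  rw [map_inv₀, ha, ← exp_neg]
theorem V.div {k l : ℤ} {a b : K} (ha : V k a) (hb : V l b) : V (k - l) (a / b) := by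
  rw [div_eq_mul_inv, sub_eq_add_neg]; exact ha.mul hb.inv
theorem V.neg {k : ℤ} {a : K} (ha : V k a) : V k (-a) := by
  unfold V; rw [Valuation.map_neg]; exact ha
theorem D.divV {k l : ℤ} {a b : K} (ha : D k a) (hb : V l b) : D (k - l) (a / b) := by
  rw [div_eq_mul_inv, sub_eq_add_neg]; exact ha.mul hb.inv.d
theorem V.sq {k : ℤ} {a : K} (ha : V k a) : V (2 * k) (a ^ 2) := by
  rw [pow_two, two_mul]; exact ha.mul ha
theorem D.sq {k : ℤ} {a : K} (ha : D k a) : D (2 * k) (a ^ 2) := by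
  rw [pow_two, two_mul]; exact ha.mul ha
theorem V.pow {k : ℤ} {a : K} (ha : V k a) (n : ℕ) : V (n * k) (a ^ n) := by
  unfold V at *
  rw [map_pow, ha, ← exp_nsmul]; simp
theorem V.zpow {k : ℤ} {a : K} (ha : V k a) (n : ℤ) : V (n * k) (a ^ n) := by
  unfold V at *
  rw [map_zpow₀, ha, ← exp_zsmul]; simp
theorem V.ne {k : ℤ} {a : K} (ha : V k a) : a ≠ 0 := by
  rintro rfl; unfold V at ha; rw [map_zero] at ha; exact exp_ne_zero ha.symm
theorem exV {a : K} (ha : a ≠ 0) : ∃ k, V k a := by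
  have h : vl.valuation K a ≠ 0 := by simpa using ha
  exact ⟨-log (vl.valuation K a), by unfold V; rw [neg_neg, exp_log h]⟩
theorem V.le_of_D {k l : ℤ} {a : K} (ha : V k a) (h : D l a) : l ≤ k := by
  unfold V at ha; unfold D at h; rw [ha, exp_le_exp] at h; omega
theorem V.uniq {k l : ℤ} {a : K} (ha : V k a) (h : V l a) : k = l :=
  le_antisymm (h.le_of_D ha.d) (ha.le_of_D h.d)
theorem V.addD {k l : ℤ} {a b : K} (ha : V k a) (hb : D l b) (hl : k < l) : V k (a + b) := by
  unfold V D at *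
  rw [Valuation.map_add_eq_of_lt_left, ha]
  rw [ha]; exact lt_of_le_of_lt hb (by rw [exp_lt_exp]; omega)
theorem V.subD {k l : ℤ} {a b : K} (ha : V k a) (hb : D l b) (hl : k < l) : V k (a - b) := by
  rw [sub_eq_add_neg]; exact ha.addD hb.neg hl
theorem D.exact {k : ℤ} {a : K} (h : D k a) (h' : ¬ D (k+1) a) : V k a := by
  have ha : a ≠ 0 := by rintro rfl; exact h' (D_zero _)
  obtain ⟨l, hl⟩ := exV ha
  have h1 := hl.le_of_D h
  have : ¬ (k + 1 ≤ l) := fun hh => h' (hl.d.mono hh)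
  have : l = k := by omega
  rwa [this] at hl

theorem D_int (r : ZI) : D 0 (algebraMap ZI K r) := by
  unfold D; rw [neg_zero, exp_zero]; exact vl.valuation_le_one r
theorem V_int {r : ZI} (h : ¬ lam ∣ r) : V 0 (algebraMap ZI K r) := by
  unfold V; rw [neg_zero, exp_zero, vl.valuation_eq_one_iff_notMem]
  change r ∉ Ideal.span {lam}
  rwa [Ideal.mem_span_singleton]
theorem V_lam : V 1 (algebraMap ZI K lam) := by
  unfold V
  rw [IsDedekindDomain.HeightOneSpectrum.valuation_of_algebraMap]
  exact vl.intValuation_singleton prime_lam.ne_zero rfl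

theorem lam_dvd_iff (r : ZI) : lam ∣ r ↔ (2:ℤ) ∣ r.re + r.im := by
  constructor
  · rintro ⟨c, rfl⟩
    simp only [lam, Zsqrtd.re_mul, Zsqrtd.im_mul]
    exact ⟨c.re, by ring⟩
  · rintro ⟨c, hc⟩
    refine ⟨⟨c, r.im - c⟩, ?_⟩
    ext
    · simp [lam]; linarith
    · simp [lam]

/-- residue field is F_2 -/
theorem V.res {u : K} (h : V 0 u) : D 1 (u - 1) := by
  obtain ⟨n, ⟨d, hd⟩, hnd⟩ := vl.exists_primeCompl_mul_eq_of_integer u (by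
    have := h.d; unfold D at this; simpa using this)
  simp only at hnd
  have hd' : ¬ lam ∣ d := by
    intro hh; exact hd (Ideal.mem_span_singleton.2 hh)
  have hvd := V_int hd'
  have hn : ¬ lam ∣ n := by
    rintro ⟨c, rfl⟩
    have h1 := h.mul hvd
    rw [hnd, map_mul] at h1
    have := h1.le_of_D (V_lam.d.mul (D_int c))
    omega
  have hsub : lam ∣ n - d := by
    rw [lam_dvd_iff] at *
    simp only [Zsqrtd.re_sub, Zsqrtd.im_sub]
    omega
  obtain ⟨c, hc⟩ := hsub
  have h3 : u - 1 = (algebraMap ZI K lam * algebraMap ZI K c) / algebraMap ZI K d := by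
    rw [← map_mul, ← hc, map_sub, ← hnd]
    field_simp [hvd.ne]
  rw [h3]
  exact ((V_lam.d.mul (D_int c)).divV hvd).mono (by norm_num)

def I : K := algebraMap ZI K ⟨0, 1⟩
def l : K := 1 + I
theorem hI : I ^ 2 = -1 := by
  unfold I; rw [← map_pow, ← map_one (algebraMap ZI K), ← map_neg]; congr 1
theorem V_l : V 1 l := by
  have := V_lam
  convert this using 1
  unfold l I; rw [← map_one (algebraMap ZI K), ← map_add]; congr 1
theorem V_I : V 0 I := V_int (by rw [lam_dvd_iff]; decide)
theorem V_1 : V 0 1 := by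
  have := V_int (r := 1) (by rw [lam_dvd_iff]; decide)
  simpa using this
theorem two_eq : (2:K) = -I * l ^ 2 := by
  unfold l; linear_combination (2 + I) * hI
theorem V_2 : V 2 (2:K) := by
  rw [two_eq]
  simpa using V_I.neg.mul V_l.sq
theorem V_unit (m n : ℤ) (h : (m + n) % 2 = 1) : V 0 ((m:K) + n * I) := by
  have := V_int (r := ⟨m, n⟩) (by rw [lam_dvd_iff]; simp only; omega)
  convert this using 1
  have h2 : (⟨m, n⟩ : ZI) = (m : ZI) + (n : ZI) * ⟨0, 1⟩ := by ext <;> simp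
  rw [h2, map_add, map_mul]; simp [I]
theorem D_intC (m : ℤ) : D 0 (m : K) := by
  have := D_int (m : ZI); simpa using this
theorem D_nat (m : ℕ) : D 0 (m : K) := by exact_mod_cast D_intC m
theorem V_4 : V 4 (4:K) := by
  have := V_2.mul V_2; norm_num at this; exact this
theorem V_odd (m : ℤ) (h : m % 2 = 1) : V 0 (m : K) := by
  have := V_unit m 0 (by omega); simpa using this
theorem V_3 : V 0 (3:K) := by exact_mod_cast V_odd 3 rfl

/-- multiplication by 2 raises by 2 -/
theorem D.two {k : ℤ} {a : K} (h : D k a) : D (k + 2) (2 * a) := by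
  rw [add_comm]; exact V_2.d.mul h
theorem D.lm {k : ℤ} {a : K} (h : D k a) : D (k + 1) (l * a) := by
  rw [add_comm]; exact V_l.d.mul h

/-- membership in `1 + 4 O`. -/
def E (z : K) : Prop := D 4 (z - 1)
theorem E.v {z : K} (h : E z) : V 0 z := by
  have := V_1.addD h (by norm_num)
  simpa using this
theorem E_one : E 1 := by unfold E; simpa using D_zero 4
theorem E.mul {a b : K} (ha : E a) (hb : E b) : E (a * b) := by
  have h1 : a * b - 1 = a * (b - 1) + (a - 1) := by ring
  unfold E; rw [h1]
  exact D.add ((ha.v.d.mul hb).mono (by norm_num)) ha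
theorem E.inv {a : K} (ha : E a) : E a⁻¹ := by
  have hv := ha.v
  have h1 : a⁻¹ - 1 = -((a - 1) / a) := by field_simp [hv.ne]; ring
  unfold E; rw [h1]
  exact ((D.divV ha hv).mono (by norm_num)).neg
theorem E.div {a b : K} (ha : E a) (hb : E b) : E (a / b) := by
  rw [div_eq_mul_inv]; exact ha.mul hb.inv
theorem E_sq {z : K} (h : D 2 (z - 1)) : E (z ^ 2) := by
  have h1 : z ^ 2 - 1 = (z - 1) ^ 2 + 2 * (z - 1) := by ring
  unfold E; rw [h1]
  exact h.sq.add h.two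

theorem V.near_l {t : K} (h : V 1 t) : D 2 (t - l) := by
  have h1 := (h.div V_l).res
  have h2 := h1.lm
  have : l * (t / l - 1) = t - l := by field_simp [V_l.ne]
  rw [this] at h2
  exact h2

theorem D.split {k : ℤ} {t : K} (h : D k t) : D (k+1) t ∨ V k t := by
  by_cases h' : D (k+1) t
  · left; exact h'
  · right; exact h.exact h'

/-- unit squares are ±1 mod 4 -/
theorem V.unit_sq {u : K} (h : V 0 u) : D 4 (u ^ 2 - 1) ∨ D 4 (u ^ 2 + 1) := by
  rcases h.res.split with h1 | h1
  · left; exact E_sq h1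
  · right
    have h2 := h1.near_l
    have e : u ^ 2 + 1 = (2 * (2 * l)) + 2 * (l * (u - 1 - l)) + (u - 1 - l) ^ 2
        + 2 * (u - 1 - l) := by
      unfold l; linear_combination (1:K) * hI
    rw [e]
    have a1 : D 4 (2 * (2 * l)) := V_l.d.two.two.mono (by norm_num)
    have a2 : D 4 (2 * (l * (u - 1 - l))) := h2.lm.two.mono (by norm_num)
    exact ((a1.add a2).add h2.sq).add h2.two
theorem V.unit_sq2 {u : K} (h : V 0 u) : D 2 (u ^ 2 - 1) := by
  rcases h.unit_sq with h1 | h1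
  · exact h1.mono (by norm_num)
  · have : u ^ 2 - 1 = u ^ 2 + 1 - 2 := by ring
    rw [this]; exact (h1.mono (by norm_num)).sub V_2.d

/-- additive perturbation statements -/
theorem not_D_of_V {k m : ℤ} {z : K} (h : V k z) (hm : k < m) : ¬ D m z := by
  intro h'; have := h.le_of_D h'; omega

theorem V_sq_even {k : ℤ} {z : K} (h : V k (z ^ 2)) : ∃ j, k = 2 * j ∧ V j z := by
  have hz : z ≠ 0 := by rintro rfl; exact h.ne (by ring)
  obtain ⟨j, hj⟩ := exV hz
  exact ⟨j, h.uniq hj.sq, hj⟩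

end
end N3M3

namespace N3M3
noncomputable section

theorem CL (M N Y : ZI) (h : M * N = Y ^ 2) (hM : M ≠ 0) :
    ∃ d r, d ∣ M ∧ d ∣ N ∧ M = d * r ^ 2 := by
  have hg : EuclideanDomain.gcd M N ≠ 0 := by
    intro hh; exact hM (EuclideanDomain.gcd_eq_zero_iff.1 hh).1
  obtain ⟨m, hm⟩ := EuclideanDomain.gcd_dvd_left M N
  obtain ⟨n, hn⟩ := EuclideanDomain.gcd_dvd_right M N
  have hb := EuclideanDomain.gcd_eq_gcd_ab M N
  set g := EuclideanDomain.gcd M N with hgdef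
  have hc : IsCoprime m n := by
    refine ⟨EuclideanDomain.gcdA M N, EuclideanDomain.gcdB M N, ?_⟩
    apply mul_left_cancel₀ hg
    linear_combination -hb - (EuclideanDomain.gcdA M N) * hm - (EuclideanDomain.gcdB M N) * hn
  have hY : g ∣ Y := by
    rw [← UniqueFactorizationMonoid.pow_dvd_pow_iff_dvd (two_ne_zero), ← h]
    exact ⟨m * n, by rw [hm, hn]; ring⟩
  obtain ⟨y, rfl⟩ := hY
  have h2 : m * n = y ^ 2 := by
    apply mul_left_cancel₀ (pow_ne_zero 2 hg)
    calc g ^ 2 * (m * n) = (g * m) * (g * n) := by ring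
      _ = M * N := by rw [← hm, ← hn]
      _ = _ := by rw [h]; ring
  obtain ⟨e, u, hu⟩ := exists_associated_pow_of_mul_eq_pow' hc h2
  refine ⟨g * u, e, ⟨e ^ 2, ?_⟩, ⟨n * (u⁻¹ : ZIˣ), ?_⟩, ?_⟩
  · conv_lhs => rw [hm, ← hu]
    ring
  · conv_lhs => rw [hn]
    have := u.mul_inv
    linear_combination (-g * n) * this
  · conv_lhs => rw [hm, ← hu]
    ring

theorem desc (a b : ZI) (X Y : K) (hX : X ≠ 0)
    (h : Y ^ 2 = X * (X ^ 2 + algebraMap ZI K a * X + algebraMap ZI K b)) :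
    ∃ (d : ZI) (r : K), d ∣ b ∧ X = algebraMap ZI K d * r ^ 2 := by
  obtain ⟨m, ⟨n, hn⟩, hmn, hx⟩ := IsFractionRing.exists_reduced_fraction ZI X
  have hn0 : n ≠ 0 := nonZeroDivisors.ne_zero hn
  have hnK : algebraMap ZI K n ≠ 0 := by simpa using hn0
  replace hx : X * algebraMap ZI K n = algebraMap ZI K m := by
    rw [← hx]; exact IsLocalization.mk'_spec K m ⟨n, hn⟩
  have hm0 : m ≠ 0 := by
    rintro rfl
    simp [hX, hn0] at hx
  have hc : IsCoprime m n := hmn.isCoprime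
  have hw : (Y * (algebraMap ZI K n) ^ 2) ^ 2 =
      algebraMap ZI K ((n * m) * (m ^ 2 + a * m * n + b * n ^ 2)) := by
    simp only [map_mul, map_add, map_pow]
    rw [mul_pow, h, ← hx]; ring
  obtain ⟨w, hw'⟩ := IsIntegrallyClosed.exists_algebraMap_eq_of_isIntegral_pow (R := ZI)
    (x := Y * (algebraMap ZI K n) ^ 2) (n := 2) (by norm_num) (by rw [hw]; exact isIntegral_algebraMap)
  rw [← hw', ← map_pow] at hw
  have hw2 := (IsFractionRing.injective ZI K hw).symm
  obtain ⟨d, r, hd1, hd2, hd3⟩ := CL _ _ _ hw2 (mul_ne_zero hn0 hm0)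
  have hcn : IsCoprime (m ^ 2 + a * m * n + b * n ^ 2) n := by
    have h1 : IsCoprime (m ^ 2) n := hc.pow_left
    have h2 := h1.add_mul_right_left (a * m + b * n)
    have e : m ^ 2 + a * m * n + b * n ^ 2 = m ^ 2 + (a * m + b * n) * n := by ring
    rw [e]; exact h2
  have hdn : IsCoprime d n := hcn.of_isCoprime_of_dvd_left hd2
  have hdm : d ∣ m := hdn.dvd_of_dvd_mul_left hd1
  have hdb : d ∣ b * n ^ 2 := by
    have : b * n ^ 2 = (m ^ 2 + a * m * n + b * n ^ 2) - m * (m + a * n) := by ring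
    rw [this]; exact dvd_sub hd2 (hdm.mul_right _)
  have hdb2 : d ∣ b := (hdn.pow_right (n := 2)).dvd_of_dvd_mul_right hdb
  refine ⟨d, algebraMap ZI K r / algebraMap ZI K n, hdb2, ?_⟩
  have h3 := congrArg (algebraMap ZI K) hd3
  simp only [map_mul, map_pow] at h3
  field_simp
  rw [← h3, ← hx]; ring

theorem unit_class (u : ZI) (h : IsUnit u) : ∃ r : K, r ≠ 0 ∧
    (algebraMap ZI K u = r ^ 2 ∨ algebraMap ZI K u = I * r ^ 2) := by
  have h1 : u.norm = 1 := by
    have := Zsqrtd.norm_eq_one_iff.2 h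
    have h2 : 0 ≤ u.norm := GaussianInt.norm_nonneg u
    omega
  obtain ⟨x, y⟩ := u
  simp only [Zsqrtd.norm] at h1
  have hx1 : x ≤ 1 := by nlinarith [mul_self_nonneg y]
  have hx2 : -1 ≤ x := by nlinarith [mul_self_nonneg y]
  have hy1 : y ≤ 1 := by nlinarith
  have hy2 : -1 ≤ y := by nlinarith
  have key : algebraMap ZI K ⟨x, y⟩ = x + y * I := by
    have h2 : (⟨x, y⟩ : ZI) = (x : ZI) + (y : ZI) * ⟨0, 1⟩ := by ext <;> simp
    rw [h2, map_add, map_mul, map_intCast, map_intCast]; rfl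
  rw [key]
  have hI0 := V_I.ne
  interval_cases x <;> interval_cases y <;> simp at h1
  · exact ⟨I, hI0, Or.inl (by push_cast; linear_combination -hI)⟩
  · exact ⟨I, hI0, Or.inr (by push_cast; linear_combination -I*hI)⟩
  · exact ⟨1, one_ne_zero, Or.inr (by push_cast; ring)⟩
  · exact ⟨1, one_ne_zero, Or.inl (by push_cast; ring)⟩

/-- the four `λ`-classes. -/
def Cls (X : K) : Prop := ∃ r : K, r ≠ 0 ∧
  (X = r ^ 2 ∨ X = I * r ^ 2 ∨ X = l * r ^ 2 ∨ X = I * l * r ^ 2)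

theorem Cls.mulsq {X r : K} (h : Cls X) (hr : r ≠ 0) : Cls (X * r ^ 2) := by
  obtain ⟨s, hs, h⟩ := h
  refine ⟨s * r, mul_ne_zero hs hr, ?_⟩
  rcases h with h | h | h | h <;> rw [h]
  · left; ring
  · right; left; ring
  · right; right; left; ring
  · right; right; right; ring

theorem lam_map : algebraMap ZI K lam = l := by
  unfold l I; rw [← map_one (algebraMap ZI K), ← map_add]; congr 1

theorem cls_unit_pow (u : ZI) (h : IsUnit u) (n : ℕ) : Cls (algebraMap ZI K (u * lam ^ n)) := by
  obtain ⟨r, hr, h⟩ := unit_class u h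
  have hl := V_l.ne
  rw [map_mul, map_pow, lam_map]
  rcases Nat.even_or_odd' n with ⟨k, rfl | rfl⟩
  · refine ⟨r * l ^ k, mul_ne_zero hr (pow_ne_zero _ hl), ?_⟩
    rcases h with h | h <;> rw [h]
    · left; ring
    · right; left; ring
  · refine ⟨r * l ^ k, mul_ne_zero hr (pow_ne_zero _ hl), ?_⟩
    rcases h with h | h <;> rw [h]
    · right; right; left; ring
    · right; right; right; ring

theorem cls_of_dvd (d : ZI) (n : ℕ) (h : d ∣ lam ^ n) : Cls (algebraMap ZI K d) := by
  obtain ⟨i, -, u, hu⟩ := (dvd_prime_pow prime_lam n).1 h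
  have : d = (u⁻¹ : ZIˣ) * lam ^ i := by
    rw [← hu]; rw [mul_comm d, ← mul_assoc]; simp
  rw [this]; exact cls_unit_pow _ (Units.isUnit _) i

def pz : ZI := ⟨5, 4⟩
theorem prime_pz : Prime pz := prime_of_norm_prime _ (by norm_num [pz, Zsqrtd.norm])

theorem cls_of_dvd_pz (d : ZI) (n : ℕ) (h : d ∣ pz * lam ^ n) :
    Cls (algebraMap ZI K d) ∨ Cls (algebraMap ZI K d / algebraMap ZI K pz) := by
  have hp : algebraMap ZI K pz ≠ 0 := by simpa using prime_pz.ne_zero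
  by_cases hd : pz ∣ d
  · obtain ⟨e, rfl⟩ := hd
    right
    rw [map_mul, mul_div_cancel_left₀ _ hp]
    exact cls_of_dvd e n ((mul_dvd_mul_iff_left prime_pz.ne_zero).1 h)
  · left
    have hc : IsCoprime d pz := ((Prime.coprime_iff_not_dvd prime_pz).2 hd).symm
    exact cls_of_dvd d n (hc.dvd_of_dvd_mul_left h)

theorem cls_of_primes (d : ZI) (hd : d ≠ 0) (h : ∀ p, Prime p → p ∣ d → p ∣ lam) :
    ∃ (u : ZI) (n : ℕ), IsUnit u ∧ d = u * lam ^ n := by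
  obtain ⟨c, hc, hnd⟩ := (FiniteMultiplicity.of_prime_left prime_lam hd).exists_eq_pow_mul_and_not_dvd
  refine ⟨c, _, ?_, by rw [mul_comm]; exact hc⟩
  by_contra hu
  have hc0 : c ≠ 0 := by rintro rfl; simp at hnd
  obtain ⟨p, hp, hpc⟩ := WfDvdMonoid.exists_irreducible_factor hu hc0
  have hp' := hp.prime
  have := h p hp' (by rw [hc]; exact hpc.mul_left _)
  have has := (hp'.associated_of_dvd prime_lam this)
  exact hnd (has.symm.dvd.trans hpc)
end
end N3M3

namespace N3M3
noncomputable section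
open WeierstrassCurve.Affine
instance decK : DecidableEq K := Classical.decEq K

abbrev W (a b : K) : WeierstrassCurve.Affine K := ⟨0, a, 0, b, 0⟩
abbrev Pt (a b : K) := (W a b).Point
/-- `S` is the affine point `(x, y)`. -/
def At {a b : K} (S : Pt a b) (x y : K) : Prop := ∃ h, S = .some x y h

variable {a b : K}

theorem At.eq {S : Pt a b} {x y : K} (h : At S x y) : y ^ 2 = x ^ 3 + a * x ^ 2 + b * x := by
  obtain ⟨h, -⟩ := h
  have := (equation_iff _ _).1 h.1
  simp at this
  exact this

theorem At.ne0 {S : Pt a b} {x y : K} (h : At S x y) : S ≠ 0 := by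
  obtain ⟨h, rfl⟩ := h
  exact Point.some_ne_zero _

theorem ex_At {S : Pt a b} (h : S ≠ 0) : ∃ x y, At S x y := by
  rcases S with _ | ⟨x, y, hh⟩
  · exact absurd rfl h
  · exact ⟨x, y, hh, rfl⟩

theorem At.uniq {S : Pt a b} {x y x' y' : K} (h : At S x y) (h' : At S x' y') : x = x' ∧ y = y' := by
  obtain ⟨h, rfl⟩ := h
  obtain ⟨h', e⟩ := h'
  simpa using e

theorem At.eqS {S S' : Pt a b} {x y : K} (h : At S x y) (h' : At S' x y) : S = S' := by
  obtain ⟨h, rfl⟩ := h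
  obtain ⟨h', rfl⟩ := h'
  rfl

theorem mk_At (hb : b ≠ 0) (hd : a ^ 2 - 4 * b ≠ 0) {x y : K} (h : y ^ 2 = x ^ 3 + a * x ^ 2 + b * x) :
    ∃ S : Pt a b, At S x y := by
  have hn : (W a b).Nonsingular x y := by
    rw [nonsingular_iff]
    refine ⟨(equation_iff _ _).2 (by simpa using h), ?_⟩
    simp only [zero_mul, sub_zero, add_zero]
    by_contra! hc
    obtain ⟨h1, h2⟩ := hc
    have hy : y = 0 := by
      have : (2:K) * y = 0 := by linear_combination h2
      simpa using this
    subst hy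
    have h3 : x * (x ^ 2 + a * x + b) = 0 := by linear_combination -h
    rcases mul_eq_zero.1 h3 with rfl | h4
    · apply hb; linear_combination -h1
    · have h5 : x * (2 * x + a) = 0 := by linear_combination -h1 - h4
      rcases mul_eq_zero.1 h5 with rfl | h6
      · apply hb; linear_combination h4
      · apply hd; linear_combination (2 * x + a) * h6 - 4 * h4
  exact ⟨.some x y hn, hn, rfl⟩

theorem At.neg {S : Pt a b} {x y : K} (h : At S x y) : At (-S) x (-y) := by
  obtain ⟨h, rfl⟩ := h
  rw [Point.neg_some]
  have e : (W a b).negY x y = -y := by simp [negY]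
  exact ⟨by rw [← e]; exact (nonsingular_neg _ _).2 h, by simp [e]⟩

theorem At.add {S S' : Pt a b} {x y x' y' : K} (h : At S x y) (h' : At S' x' y') (hx : x ≠ x') :
    At (S + S') (((y - y') / (x - x')) ^ 2 - a - x - x')
      (-((y - y') / (x - x') * ((((y - y') / (x - x')) ^ 2 - a - x - x') - x) + y)) := by
  obtain ⟨h, rfl⟩ := h
  obtain ⟨h', rfl⟩ := h'
  have e := Point.add_some (h₁ := h) (h₂ := h') (fun hh => hx hh.1)
  rw [e]
  have e1 : (W a b).addX x x' ((W a b).slope x x' y y') = ((y - y') / (x - x')) ^ 2 - a - x - x' := by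
    rw [slope_of_X_ne hx]; simp [addX]
  have e2 : (W a b).addY x x' y ((W a b).slope x x' y y') =
      (-((y - y') / (x - x') * ((((y - y') / (x - x')) ^ 2 - a - x - x') - x) + y)) := by
    rw [← e1, slope_of_X_ne hx]; simp [addY, negAddY, negY]
  rw [← e2, ← e1]
  exact ⟨_, rfl⟩

theorem At.dbl {S : Pt a b} {x y : K} (h : At S x y) (hy : y ≠ 0) :
    ∃ y', At (S + S) (((x ^ 2 - b) / (2 * y)) ^ 2) y' := by
  have heq := h.eq
  obtain ⟨h, rfl⟩ := h
  have hn : y ≠ (W a b).negY x y := by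
    simp only [negY, zero_mul, sub_zero]
    intro hh
    apply hy
    have : (2:K) * y = 0 := by linear_combination hh
    simpa using this
  have e := Point.add_self_of_Y_ne (h₁ := h) hn
  rw [e]
  have e1 : (W a b).addX x x ((W a b).slope x x y y) = (((x ^ 2 - b) / (2 * y)) ^ 2) := by
    rw [slope_of_Y_ne rfl hn]; simp [addX, negY]
    rw [show y + y = 2 * y by ring]
    field_simp
    linear_combination (-4 * a - 8 * x) * heq
  rw [← e1]
  exact ⟨_, _, rfl⟩

theorem At.eq_or {S S' : Pt a b} {x y y' : K} (h : At S x y) (h' : At S' x y') : S = S' ∨ S = -S' := by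
  have h1 := h.eq
  have h2 := h'.eq
  have : (y - y') * (y + y') = 0 := by linear_combination h1 - h2
  rcases mul_eq_zero.1 this with h3 | h3
  · left
    have : y = y' := by linear_combination h3
    subst this; exact h.eqS h'
  · right
    have : y = - y' := by linear_combination h3
    subst this; exact h.eqS h'.neg

theorem At.dbl0 {S : Pt a b} {x : K} (h : At S x 0) : S + S = 0 := by
  have h1 := h.neg
  rw [neg_zero] at h1
  have h2 := h.eqS h1
  nth_rewrite 2 [h2]
  exact add_neg_cancel S

/-- sum with square-class information -/
theorem At.add' {S S' : Pt a b} {x y x' y' : K} (h : At S x y) (h' : At S' x' y') (hx : x ≠ x')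
    (h0 : x ≠ 0) (h0' : x' ≠ 0) :
    ∃ y3, At (S + S') (((y * x' - y' * x) / (x - x')) ^ 2 / (x * x')) y3 := by
  have h1 := h.add h' hx
  have hs : x - x' ≠ 0 := sub_ne_zero.2 hx
  have e : ((y - y') / (x - x')) ^ 2 - a - x - x' = ((y * x' - y' * x) / (x - x')) ^ 2 / (x * x') := by
    field_simp
    linear_combination (x * x' - x' ^ 2) * h.eq + (x * x' - x ^ 2) * h'.eq
  rw [e] at h1
  exact ⟨_, h1⟩

theorem At.addT {S T : Pt a b} {x y : K} (h : At S x y) (hT : At T 0 0) (h0 : x ≠ 0) :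
    ∃ y', At (S + T) (b / x) y' := by
  have h1 := h.add hT h0
  have e : ((y - 0) / (x - 0)) ^ 2 - a - x - 0 = b / x := by
    simp only [sub_zero]
    field_simp
    linear_combination h.eq
  rw [e] at h1
  exact ⟨_, h1⟩

theorem At.T {S T : Pt a b} {y : K} (h : At S 0 y) (hT : At T 0 0) : S = T := by
  have h1 := h.eq
  have : y = 0 := by
    have : y ^ 2 = 0 := by linear_combination h1
    simpa using this
  subst this
  exact h.eqS hT

/-- halving -/
theorem At.halve (hb : b ≠ 0) (hd : a ^ 2 - 4 * b ≠ 0) {S : Pt a b} {r s m : K}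
    (h : At S (r ^ 2) (r * s)) (h0 : r ≠ 0) (hk : 2 * r ^ 2 + a + 2 * s = m ^ 2) :
    ∃ S', S = S' + S' := by
  have heq := h.eq
  have hs : s ^ 2 = r ^ 4 + a * r ^ 2 + b := by
    apply mul_left_cancel₀ (pow_ne_zero 2 h0)
    linear_combination heq
  have hm : m ≠ 0 := by
    rintro rfl
    apply hd
    linear_combination (2 * r ^ 2 + a - 2 * s) * hk + 4 * hs
  have hbf : b = (s + r ^ 2 - r * m) * (s + r ^ 2 + r * m) := by
    linear_combination -r ^ 2 * hk - hs
  have hx : s + r ^ 2 + r * m ≠ 0 := by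
    intro hh; rw [hh, mul_zero] at hbf; exact hb hbf
  obtain ⟨S', hS'⟩ := mk_At hb hd (x := s + r ^ 2 + r * m) (y := m * (s + r ^ 2 + r * m)) (by
    linear_combination (s + r ^ 2 + r * m) * (-(s + r ^ 2 + r * m) * hk - hbf))
  obtain ⟨y', hy'⟩ := hS'.dbl (mul_ne_zero hm hx)
  have e : (((s + r ^ 2 + r * m) ^ 2 - b) / (2 * (m * (s + r ^ 2 + r * m)))) = r := by
    have : (s + r ^ 2 + r * m) ^ 2 - b = r * (2 * (m * (s + r ^ 2 + r * m))) := by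
      linear_combination -hbf
    rw [this]; field_simp
  rw [e] at hy'
  rcases h.eq_or hy' with h1 | h1
  · exact ⟨S', h1⟩
  · exact ⟨-S', by rw [h1]; abel⟩

/-- subgroup generated by `P`, `T` and doubles -/
def HH (P T : Pt a b) : AddSubgroup (Pt a b) where
  carrier := {S | ∃ (m n : ℤ) (S' : Pt a b), S = m • P + n • T + (S' + S')}
  zero_mem' := ⟨0, 0, 0, by simp⟩
  add_mem' := by
    rintro _ _ ⟨m, n, S, rfl⟩ ⟨m', n', S', rfl⟩
    exact ⟨m + m', n + n', S + S', by rw [add_zsmul, add_zsmul]; abel⟩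
  neg_mem' := by
    rintro _ ⟨m, n, S, rfl⟩
    exact ⟨-m, -n, -S, by rw [neg_zsmul, neg_zsmul]; abel⟩

theorem HH.P {P T : Pt a b} : P ∈ HH P T := ⟨1, 0, 0, by simp⟩
theorem HH.T {P T : Pt a b} : T ∈ HH P T := ⟨0, 1, 0, by simp⟩
theorem HH.dbl {P T : Pt a b} (S : Pt a b) : S + S ∈ HH P T := ⟨0, 0, S, by simp⟩

theorem HH.cases {P T S : Pt a b} (h : S ∈ HH P T) : ∃ S', S = S' + S' ∨ S = T + (S' + S') ∨
    S = P + (S' + S') ∨ S = P + T + (S' + S') := by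
  obtain ⟨m, n, S', rfl⟩ := h
  rcases Int.even_or_odd' m with ⟨i, rfl | rfl⟩ <;> rcases Int.even_or_odd' n with ⟨j, rfl | rfl⟩
  · exact ⟨i • P + j • T + S', Or.inl (by rw [two_mul, two_mul, add_zsmul, add_zsmul]; abel)⟩
  · exact ⟨i • P + j • T + S', Or.inr (Or.inl (by
      rw [two_mul, two_mul, add_zsmul, add_zsmul, add_zsmul, one_zsmul]; abel))⟩
  · exact ⟨i • P + j • T + S', Or.inr (Or.inr (Or.inl (by
      rw [two_mul, two_mul, add_zsmul, add_zsmul, add_zsmul, one_zsmul]; abel)))⟩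
  · exact ⟨i • P + j • T + S', Or.inr (Or.inr (Or.inr (by
      rw [two_mul, two_mul, add_zsmul, add_zsmul, add_zsmul, add_zsmul, one_zsmul, one_zsmul]; abel)))⟩
end
end N3M3

namespace N3M3
noncomputable section
variable {a b : K}

theorem V.not_sq {k : ℤ} {N : K} (h : V k (N ^ 2)) (hk : k % 2 = 1) : False := by
  obtain ⟨j, hj, -⟩ := V_sq_even h; omega

theorem V_1mI : V 1 (1 - I) := by
  have : 1 - I = -I * l := by unfold l; linear_combination hI
  rw [this]; simpa using V_I.neg.mul V_l

theorem nsI {u : K} (h : D 2 (u ^ 2 - I)) : False := by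
  have h1 : V 0 (u ^ 2) := by
    have := V_I.addD h (by norm_num)
    simpa using this
  obtain ⟨j, hj, hu⟩ := V_sq_even h1
  obtain rfl : j = 0 := by omega
  have h2 := hu.unit_sq2
  have h3 := h.sub h2
  rw [show u ^ 2 - I - (u ^ 2 - 1) = 1 - I by ring] at h3
  exact not_D_of_V V_1mI (by norm_num) h3

theorem nsI' {u : K} (h : D 2 (u ^ 2 + I)) : False := by
  apply nsI (u := u)
  have := h.sub (V_2.mul V_I).d
  convert this using 1; ring

theorem Cls_of (A B : ZI) (n : ℕ) (hB : B ∣ lam ^ n) {S : Pt (algebraMap ZI K A) (algebraMap ZI K B)}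
    {x y : K} (h : At S x y) (hx : x ≠ 0) : Cls x := by
  obtain ⟨d, r, hd, e⟩ := desc A B x y hx (by rw [h.eq]; ring)
  have h1 := cls_of_dvd d n (hd.trans hB)
  rw [e]
  apply h1.mulsq
  rintro rfl; simp at e; exact hx e

theorem Cls.inv {X : K} (h : Cls X) : Cls X⁻¹ := by
  obtain ⟨r, hr, h⟩ := id h
  by_cases hX : X = 0
  · subst hX; simpa using ‹Cls 0›
  · have := Cls.mulsq ‹Cls X› (inv_ne_zero hX)
    convert this using 1
    field_simp

def SqIn (P T : Pt a b) : Prop := ∀ S r y, r ≠ 0 → At S (r ^ 2) y → S ∈ HH P T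

theorem SqIn.addP {P T S : Pt a b} (H : SqIn P T) (hT : At T 0 0) {x y x0 y0 t : K} (hP : At P x0 y0) (h : At S x y)
    (h0 : x ≠ 0) (h1 : x0 ≠ 0) (ht : x * x0 = t ^ 2) : S ∈ HH P T := by
  by_cases hx : x = x0
  · subst hx
    rcases h.eq_or hP with rfl | rfl
    · exact HH.P
    · exact neg_mem HH.P
  · obtain ⟨y3, h3⟩ := h.add' hP hx h0 h1
    rw [ht, ← div_pow] at h3
    have : S + P ∈ HH P T := by
      by_cases hz : (y * x0 - y0 * x) / (x - x0) / t = 0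
      · rw [hz] at h3
        have := At.T (by simpa using h3) hT
        rw [this]; exact HH.T
      · exact H _ _ _ hz h3
    have := sub_mem this (HH.P (P := P) (T := T))
    simpa using this

theorem addT {P T S : Pt a b} (hT : At T 0 0) {x y : K} (h : At S x y)
    (h0 : x ≠ 0) (H : ∀ S y, At S (b / x) y → S ∈ HH P T) : S ∈ HH P T := by
  obtain ⟨y', h'⟩ := h.addT hT h0
  have := sub_mem (H _ _ h') (HH.T (P := P) (T := T))
  simpa using this

theorem SqIn.addT {P T S : Pt a b} (H : SqIn P T) (hb : b ≠ 0) (hT : At T 0 0) {x y t : K} (h : At S x y)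
    (h0 : x ≠ 0) (ht : b * x = t ^ 2) : S ∈ HH P T := by
  apply N3M3.addT hT h h0
  intro S y hS
  have e : b / x = (t / x) ^ 2 := by
    rw [div_pow, ← ht]; field_simp
  rw [e] at hS
  refine H _ _ _ ?_ hS
  intro hh
  rw [hh] at e
  have : b / x ≠ 0 := div_ne_zero hb h0
  exact this (by rw [e]; ring)

theorem kclass (A B : ZI) (n : ℕ) (c : K) (hc : c ≠ 0) (hB : A ^ 2 - 4 * B ∣ pz * lam ^ n)
    (ha : a = algebraMap ZI K A) (hb : b = algebraMap ZI K B)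
    (hc' : a ^ 2 - 4 * b = algebraMap ZI K pz * c ^ 2) {P T : Pt a b}
    (H : ∀ (S : Pt a b) (r s k N : K), r ≠ 0 → At S (r ^ 2) (r * s) → k = 2 * r ^ 2 + a + 2 * s → k ≠ 0 →
      k + (a ^ 2 - 4 * b) / k - 2 * a = N ^ 2 → Cls k → S ∈ HH P T) : SqIn P T := by
  have hp : algebraMap ZI K pz ≠ 0 := by simpa using prime_pz.ne_zero
  have hd : a ^ 2 - 4 * b ≠ 0 := by rw [hc']; exact mul_ne_zero hp (pow_ne_zero 2 hc)
  intro S r y hr hS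
  obtain ⟨s, rfl⟩ : ∃ s, y = r * s := ⟨y / r, by field_simp⟩
  have heq := hS.eq
  have hs : s ^ 2 = r ^ 4 + a * r ^ 2 + b := by
    apply mul_left_cancel₀ (pow_ne_zero 2 hr)
    linear_combination heq
  have hkk : (2 * r ^ 2 + a + 2 * s) * (2 * r ^ 2 + a - 2 * s) = a ^ 2 - 4 * b := by
    linear_combination -4 * hs
  have hk : (2 * r ^ 2 + a + 2 * s) ≠ 0 := by
    intro h; rw [h, zero_mul] at hkk; exact hd hkk.symm
  have hk' : (2 * r ^ 2 + a - 2 * s) ≠ 0 := by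
    intro h; rw [h, mul_zero] at hkk; exact hd hkk.symm
  set k := 2 * r ^ 2 + a + 2 * s with hkdef
  set k' := 2 * r ^ 2 + a - 2 * s with hkdef'
  obtain ⟨d, m, hdd, hm⟩ := desc (-2 * A) (A ^ 2 - 4 * B) k (2 * r * k) hk (by
    simp only [map_sub, map_mul, map_pow, map_neg, map_ofNat, ← ha, ← hb, ← hkk]
    rw [hkdef, hkdef']; ring)
  have hm0 : m ≠ 0 := by rintro rfl; simp at hm; exact hk hm
  rcases cls_of_dvd_pz d n (hdd.trans hB) with h1 | h1
  · refine H S r s k (2 * r) hr hS hkdef hk ?_ (by rw [hm]; exact h1.mulsq hm0)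
    rw [← hkk]; field_simp; rw [hkdef, hkdef']; ring
  · refine H S (-r) (-s) k' (2 * r) (neg_ne_zero.2 hr) ?_ ?_ hk' ?_ ?_
    · convert hS using 1 <;> ring
    · rw [hkdef']; ring
    · rw [← hkk]; field_simp; rw [hkdef, hkdef']; ring
    · have h2 := (h1.mulsq hm0).inv.mulsq hc
      convert h2 using 1
      have e : algebraMap ZI K d * m ^ 2 ≠ 0 := by rw [← hm]; exact hk
      have e2 : algebraMap ZI K d ≠ 0 := left_ne_zero_of_mul e
      field_simp
      rw [mul_assoc k', mul_comm k', ← hm, hkk, hc']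

theorem oddExcl {k b' N : K} {j : ℤ} (ha : D 0 a) (hk : V j k) (hj : j % 2 = 1) (hb' : V 0 b')
    (h : k + b' / k - 2 * a = N ^ 2) : False := by
  have h1 := hb'.div hk
  have h2 := ha.two
  rcases lt_or_ge j 0 with h3 | h3
  · have := (hk.addD h1.d (by omega)).subD h2 (by omega)
    rw [h] at this; exact this.not_sq hj
  · have := (h1.addD hk.d (by omega)).subD h2 (by omega)
    rw [add_comm, h] at this; exact this.not_sq (by omega)

theorem pz_map : algebraMap ZI K pz = 5 + 4 * I := by
  have h2 : pz = (5 : ZI) + (4 : ZI) * ⟨0, 1⟩ := by ext <;> simp [pz]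
  rw [h2, map_add, map_mul, map_ofNat, map_ofNat]; rfl

theorem D_pz : D 5 (5 + 4 * I - 1) := by
  have := V_4.mul V_l
  have e : 5 + 4 * I - 1 = 4 * l := by unfold l; ring
  rw [e]; exact this.d
theorem V_pz : V 0 (5 + 4 * I) := by
  have := V_1.addD D_pz (by norm_num)
  convert this using 1; ring

theorem X1 {m N : K} (hm : m ≠ 0) (h : I * m ^ 2 + (5 + 4 * I) / (I * m ^ 2) - 6 = N ^ 2) : False := by
  have hI0 := V_I.ne
  have hinv : (5 + 4 * I) / (I * m ^ 2) = - I * (5 + 4 * I) / m ^ 2 := by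
    field_simp; linear_combination (5 + 4 * I) * hI
  rw [hinv] at h
  have V6 : V 2 (6:K) := by
    have := V_2.mul V_3; norm_num at this; exact this
  obtain ⟨j, hj⟩ := exV hm
  rcases lt_trichotomy j 0 with hj0 | rfl | hj0
  · apply nsI (u := N / m)
    have e : (N / m) ^ 2 - I = -(6 / m ^ 2) - I * (5 + 4 * I) / (m ^ 2) ^ 2 := by
      rw [div_pow, ← h]; field_simp; ring
    rw [e]
    refine (((V6.div hj.sq).d).mono (by omega)).neg.sub ?_
    exact ((V_I.mul V_pz).div hj.sq.sq).d.mono (by omega)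
  · have h1 := hj.unit_sq2
    have h2 : D 4 (m ^ 2 * m ^ 2 - 1) := by
      have : m ^ 2 * m ^ 2 - 1 = (m ^ 2 - 1) ^ 2 + 2 * (m ^ 2 - 1) := by ring
      rw [this]; exact (h1.sq.add h1.two).mono (by norm_num)
    have h3 : D 4 (N ^ 2 + 6) := by
      have e : N ^ 2 + 6 = I * ((m ^ 2 * m ^ 2 - 1) - (5 + 4 * I - 1)) / m ^ 2 := by
        rw [← h]; field_simp; ring
      rw [e]
      exact ((V_I.d.mul (h2.sub (D_pz.mono (by norm_num)))).divV hj.sq).mono (by norm_num)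
    have h4 : V 2 (N ^ 2) := by
      have := V6.neg.addD h3 (by norm_num)
      convert this using 1; ring
    obtain ⟨i, hi, hN⟩ := V_sq_even h4
    obtain rfl : i = 1 := by omega
    -- N² = 2 I n²
    have hn := hN.div V_l
    have hl0 := V_l.ne
    have e2 : N ^ 2 = 2 * I * (N / l) ^ 2 := by
      have hl2 : l ^ 2 = 2 * I := by unfold l; linear_combination hI
      have : N ^ 2 = l ^ 2 * (N / l) ^ 2 := by field_simp
      rw [this, hl2]
    rw [e2] at h3
    have h5 := (hn.res)
    have h6 := h3.divV V_2
    have e3 : (2 * I * (N / l) ^ 2 + 6) / 2 = I * (N / l) ^ 2 + 3 := by field_simp; ring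
    rw [e3] at h6
    apply nsI' (u := N / l)
    have e4 : (N / l) ^ 2 + I = -I * (I * (N / l) ^ 2 + 3) + 4 * I := by
      linear_combination ((N / l) ^ 2) * hI
    rw [e4]
    exact ((V_I.neg.d.mul h6).mono (by norm_num)).add ((V_4.mul V_I).d.mono (by norm_num))
  · apply nsI' (u := N * m)
    have e : (N * m) ^ 2 + I = I * (m ^ 2) ^ 2 - 6 * m ^ 2 - I * (5 + 4 * I - 1) := by
      rw [mul_pow, ← h]; field_simp; ring
    rw [e]
    refine ((((V_I.mul hj.sq.sq).d).mono (by omega)).sub ((V6.mul hj.sq).d.mono (by omega))).sub ?_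
    exact (V_I.d.mul D_pz).mono (by norm_num)
end
end N3M3

namespace N3M3
noncomputable section

theorem V_6 : V 2 (6:K) := by
  have := V_2.mul V_3; norm_num at this; exact this
theorem hl2 : l ^ 2 = 2 * I := by unfold l; linear_combination hI

/-- exclusion in the class step for `ε = I` -/
theorem X2 {m N : K} (hm : m ≠ 0) (h : -I * (m ^ 2) ^ 2 - 3 * I * m ^ 2 - l = N ^ 2) : False := by
  obtain ⟨j, hj⟩ := exV hm
  rcases lt_trichotomy j 0 with hj0 | rfl | hj0
  · apply nsI' (u := N / m ^ 2)
    have e : (N / m ^ 2) ^ 2 + I = -(3 * I / m ^ 2) - l / (m ^ 2) ^ 2 := by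
      rw [div_pow, ← h]; field_simp; ring
    rw [e]
    exact (((V_3.mul V_I).div hj.sq).d.mono (by omega)).neg.sub ((V_l.div hj.sq.sq).d.mono (by omega))
  · have h1 := hj.unit_sq2
    have e : N ^ 2 = -l - I * (m ^ 2 * ((m ^ 2 - 1) + 4)) := by rw [← h]; ring
    have h2 : V 1 (N ^ 2) := by
      rw [e]
      refine V_l.neg.subD (V_I.d.mul (hj.sq.d.mul (h1.add (V_4.d.mono (by norm_num))))) (by norm_num)
    exact h2.not_sq (by norm_num)
  · have e : N ^ 2 = -l - I * (m ^ 2 * (m ^ 2 + 3)) := by rw [← h]; ring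
    have h2 : V 1 (N ^ 2) := by
      rw [e]
      refine V_l.neg.subD (V_I.d.mul (hj.sq.d.mul ((hj.sq.d.mono (by omega)).add V_3.d))) (by omega)
    exact h2.not_sq (by norm_num)

theorem X3 {m N : K} (hm : m ≠ 0)
    (h : I * m ^ 2 + l ^ 2 * (5 + 4 * I) / (I * m ^ 2) - 6 * l = N ^ 2) : False := by
  have hI0 := V_I.ne
  have hl0 := V_l.ne
  have hinv : l ^ 2 * (5 + 4 * I) / (I * m ^ 2) = - I * l ^ 2 * (5 + 4 * I) / m ^ 2 := by
    field_simp; linear_combination (5 + 4 * I) * hI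
  rw [hinv] at h
  obtain ⟨j, hj⟩ := exV hm
  rcases le_or_gt j 0 with hj0 | hj0
  · apply nsI (u := N / m)
    have e : (N / m) ^ 2 - I = -(6 * l / m ^ 2) - I * l ^ 2 * (5 + 4 * I) / (m ^ 2) ^ 2 := by
      rw [div_pow, ← h]; field_simp; ring
    rw [e]
    exact (((V_6.mul V_l).div hj.sq).d.mono (by omega)).neg.sub
      ((((V_I.mul V_l.sq).mul V_pz).div hj.sq.sq).d.mono (by omega))
  · apply nsI' (u := N * m / l)
    have e : (N * m / l) ^ 2 + I = I * (m ^ 2) ^ 2 / l ^ 2 - 6 * m ^ 2 / l - I * (5 + 4 * I - 1) := by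
      rw [div_pow, mul_pow, ← h]; field_simp; ring
    rw [e]
    refine ((((V_I.mul hj.sq.sq).div V_l.sq).d.mono (by omega)).sub
      (((V_6.mul hj.sq).div V_l).d.mono (by omega))).sub ?_
    exact (V_I.d.mul D_pz).mono (by norm_num)

theorem oddl {c m N : K} {j : ℤ} (hc : V 0 c) (hj : V j m) (hj0 : j ≠ 0)
    (h : c * l * m ^ 2 + l ^ 2 * (5 + 4 * I) / (c * l * m ^ 2) - 6 * l = N ^ 2) : False := by
  have h1 := (hc.mul V_l).mul hj.sq
  have h2 := (V_l.sq.mul V_pz).div h1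
  have h3 := V_6.mul V_l
  rcases lt_or_gt_of_ne hj0 with h4 | h4
  · have := (h1.addD h2.d (by omega)).subD h3.d (by omega)
    rw [h] at this; exact this.not_sq (by omega)
  · have := (h2.addD h1.d (by omega)).subD h3.d (by omega)
    rw [add_comm (l ^ 2 * (5 + 4 * I) / (c * l * m ^ 2)), h] at this; exact this.not_sq (by omega)

theorem X4 {m N : K} (hm : m ≠ 0)
    (h : l * m ^ 2 + l ^ 2 * (5 + 4 * I) / (l * m ^ 2) - 6 * l = N ^ 2) : False := by
  have hl0 := V_l.ne
  obtain ⟨j, hj⟩ := exV hm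
  by_cases hj0 : j = 0
  swap
  · exact oddl (c := 1) V_1 hj hj0 (by simpa using h)
  subst hj0
  have e : (N * m) ^ 2 = l * ((m ^ 2 - 3) ^ 2 - 4 + 4 * I) := by
    rw [mul_pow, ← h]; field_simp; ring
  rcases hj.unit_sq with h1 | h1
  · have h2 : D 8 ((m ^ 2 - 3) ^ 2 - 4) := by
      have : (m ^ 2 - 3) ^ 2 - 4 = (m ^ 2 - 1) ^ 2 - 4 * (m ^ 2 - 1) := by ring
      rw [this]; exact h1.sq.sub (V_4.d.mul h1)
    have h3 : V 4 ((m ^ 2 - 3) ^ 2 - 4 + 4 * I) := by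
      rw [add_comm]; exact (V_4.mul V_I).addD h2 (by norm_num)
    have h4 := V_l.mul h3
    rw [← e] at h4
    exact h4.not_sq (by norm_num)
  · have h2 : D 4 (m ^ 2 - 3) := by
      have := h1.sub V_4.d
      convert this using 1; ring
    have h3 := h2.sq
    apply nsI' (u := N * m / l ^ 3)
    have e2 : (N * m / l ^ 3) ^ 2 + I = l * (m ^ 2 - 3) ^ 2 / l ^ 6 := by
      have e6 : l ^ 5 * I = 4 - 4 * I := by
        unfold l; linear_combination (I ^ 4 + 5 * I ^ 3 + 9 * I ^ 2 + 5 * I - 4) * hI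
      rw [div_pow, e]
      field_simp
      linear_combination e6
    rw [e2]
    exact ((V_l.d.mul h3).divV (V_l.pow 6)).mono (by norm_num)

theorem X5 {m N : K} (hm : m ≠ 0)
    (h : I * l * m ^ 2 + l ^ 2 * (5 + 4 * I) / (I * l * m ^ 2) - 6 * l = N ^ 2) : False := by
  have hl0 := V_l.ne
  have hI0 := V_I.ne
  obtain ⟨j, hj⟩ := exV hm
  by_cases hj0 : j = 0
  swap
  · exact oddl (c := I) V_I hj hj0 h
  subst hj0
  have hinv : l ^ 2 * (5 + 4 * I) / (I * l * m ^ 2) = - I * l * (5 + 4 * I) / m ^ 2 := by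
    field_simp; linear_combination (5 + 4 * I) * hI
  rw [hinv] at h
  have e : (N * m) ^ 2 = I * l * ((m ^ 2 + 3 * I) ^ 2 + 4 * (1 - I)) := by
    rw [mul_pow, ← h]; field_simp; linear_combination (-9 * I - 6 * m ^ 2) * hI
  have h1 := hj.unit_sq2
  have h2 : V 1 (m ^ 2 + 3 * I) := by
    have := V_l.addD (h1.add (V_2.mul V_I).d) (by norm_num)
    convert this using 1; unfold l; ring
  have h3 := h2.sq.addD (V_4.mul V_1mI).d (by norm_num)
  have h4 := (V_I.mul V_l).mul h3
  rw [← e] at h4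
  exact h4.not_sq (by norm_num)
end
end N3M3

namespace N3M3
noncomputable section

theorem k_identity (a r s r0 s0 r3 y3 : K) (hd : r ^ 2 - r0 ^ 2 ≠ 0)
    (ha : a * (r ^ 2 - r0 ^ 2) = s ^ 2 - s0 ^ 2 - r ^ 4 + r0 ^ 4)
    (h3 : r3 = (s * r0 - s0 * r) / (r ^ 2 - r0 ^ 2))
    (hy : y3 = -((r * s - r0 * s0) / (r ^ 2 - r0 ^ 2) * (r3 ^ 2 - r ^ 2) + r * s)) :
    ((2 * r3 ^ 2 + a) * r3 + 2 * y3) * ((2 * r0 ^ 2 + a + 2 * s0) - (2 * r ^ 2 + a + 2 * s)) ^ 2 =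
      4 * (2 * r ^ 2 + a + 2 * s) * (2 * r0 ^ 2 + a + 2 * s0) * (r - r0) ^ 2 * r3 := by
  have ha' : a = (s ^ 2 - s0 ^ 2 - r ^ 4 + r0 ^ 4) / (r ^ 2 - r0 ^ 2) := by
    rw [← ha]; field_simp
  subst hy h3 ha'
  field_simp
  ring

theorem addPk {a b : K} (hb : b ≠ 0) (hd : a ^ 2 - 4 * b ≠ 0) {P T S : Pt a b} (hT : At T 0 0)
    {r s r0 s0 t : K} (hS : At S (r ^ 2) (r * s)) (hP : At P (r0 ^ 2) (r0 * s0)) (hr : r ≠ 0) (hr0 : r0 ≠ 0)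
    (ht : (2 * r ^ 2 + a + 2 * s) * (2 * r0 ^ 2 + a + 2 * s0) = t ^ 2) (ht0 : t ≠ 0) : S ∈ HH P T := by
  by_cases hx : r ^ 2 = r0 ^ 2
  · rw [hx] at hS
    rcases hS.eq_or hP with rfl | rfl
    · exact HH.P
    · exact neg_mem HH.P
  have hdd : r ^ 2 - r0 ^ 2 ≠ 0 := sub_ne_zero.2 hx
  have h3 := hS.add hP hx
  have hs : s ^ 2 = r ^ 4 + a * r ^ 2 + b := by
    apply mul_left_cancel₀ (pow_ne_zero 2 hr)
    linear_combination hS.eq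
  have hs0 : s0 ^ 2 = r0 ^ 4 + a * r0 ^ 2 + b := by
    apply mul_left_cancel₀ (pow_ne_zero 2 hr0)
    linear_combination hP.eq
  have ha : a * (r ^ 2 - r0 ^ 2) = s ^ 2 - s0 ^ 2 - r ^ 4 + r0 ^ 4 := by
    linear_combination hs0 - hs
  obtain ⟨r3, h3r⟩ : ∃ r3, r3 = (s * r0 - s0 * r) / (r ^ 2 - r0 ^ 2) := ⟨_, rfl⟩
  have hx3 : ((r * s - r0 * s0) / (r ^ 2 - r0 ^ 2)) ^ 2 - a - r ^ 2 - r0 ^ 2 = r3 ^ 2 := by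
    have ha' : a = (s ^ 2 - s0 ^ 2 - r ^ 4 + r0 ^ 4) / (r ^ 2 - r0 ^ 2) := by
      rw [← ha]; field_simp
    rw [ha', h3r]
    field_simp
    ring
  rw [hx3] at h3
  have key := k_identity a r s r0 s0 r3 _ hdd ha h3r rfl
  set y3 := -((r * s - r0 * s0) / (r ^ 2 - r0 ^ 2) * (r3 ^ 2 - r ^ 2) + r * s) with hy3
  have : S + P ∈ HH P T := by
    by_cases hz : r3 = 0
    · rw [hz] at h3
      have := At.T (by simpa using h3) hT
      rw [this]; exact HH.T
    · have e0 : y3 = r3 * (y3 / r3) := by field_simp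
      rw [e0] at h3
      set w := (2 * r0 ^ 2 + a + 2 * s0) - (2 * r ^ 2 + a + 2 * s) with hw
      rw [show 4 * (2 * r ^ 2 + a + 2 * s) * (2 * r0 ^ 2 + a + 2 * s0) * (r - r0) ^ 2 * r3 =
        4 * ((2 * r ^ 2 + a + 2 * s) * (2 * r0 ^ 2 + a + 2 * s0)) * (r - r0) ^ 2 * r3 by ring, ht] at key
      have hrr : r - r0 ≠ 0 := by
        intro h; apply hdd; linear_combination (r + r0) * h
      have hw0 : w ≠ 0 := by
        intro h
        rw [h] at key
        have : 4 * t ^ 2 * (r - r0) ^ 2 * r3 ≠ 0 := mul_ne_zero (mul_ne_zero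
          (mul_ne_zero V_4.ne (pow_ne_zero 2 ht0)) (pow_ne_zero 2 hrr)) hz
        exact this (by rw [← key]; ring)
      obtain ⟨S', hS'⟩ := h3.halve hb hd hz (m := 2 * t * (r - r0) / w) (by
        field_simp
        linear_combination key)
      rw [hS']; exact HH.dbl _
  have := sub_mem this (HH.P (P := P) (T := T))
  simpa using this

/-! ε = 1 -/
theorem MW1 {P T : Pt (3:K) (1 - I)} (hP : At P (-I) (2 * I)) (hT : At T 0 0) (S : Pt (3:K) (1 - I)) :
    S ∈ HH P T := by
  have hI0 := V_I.ne
  have hb : 1 - I ≠ 0 := V_1mI.ne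
  have hB : algebraMap ZI K ⟨1, -1⟩ = 1 - I := by
    have h2 : (⟨1, -1⟩ : ZI) = (1 : ZI) - ⟨0, 1⟩ := by ext <;> simp
    rw [h2, map_sub, map_one]; rfl
  have hA : algebraMap ZI K 3 = 3 := map_ofNat _ 3
  have hd' : (3:K) ^ 2 - 4 * (1 - I) = 5 + 4 * I := by ring
  have hd : (3:K) ^ 2 - 4 * (1 - I) ≠ 0 := by rw [hd']; exact V_pz.ne
  have hsq : SqIn P T := by
    apply kclass 3 ⟨1, -1⟩ 0 1 one_ne_zero (by
      have : (3:ZI) ^ 2 - 4 * ⟨1, -1⟩ = pz * lam ^ 0 := by ext <;> decide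
      rw [this]) hA.symm hB.symm (by rw [pz_map]; ring)
    intro S r s k N hr hS hk hk0 hN hc
    rw [hd'] at hN
    obtain ⟨m, hm, h | h | h | h⟩ := hc
    · obtain ⟨S', hS'⟩ := hS.halve hb hd hr (m := m) (by rw [← hk, h])
      rw [hS']; exact HH.dbl _
    · exfalso
      rw [h] at hN
      exact X1 hm (N := N) (by rw [← hN]; ring)
    · exfalso
      obtain ⟨j, hj⟩ := exV hm
      have hv := V_l.mul hj.sq
      rw [← h] at hv
      exact oddExcl V_3.d hv (by omega) V_pz hN
    · exfalso
      obtain ⟨j, hj⟩ := exV hm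
      have hv := (V_I.mul V_l).mul hj.sq
      rw [← h] at hv
      exact oddExcl V_3.d hv (by omega) V_pz hN
  by_cases hS0 : S = 0
  · rw [hS0]; exact zero_mem _
  obtain ⟨x, y, hS⟩ := ex_At hS0
  by_cases hx : x = 0
  · subst hx; rw [hS.T hT]; exact HH.T
  have claimI : ∀ (S : Pt (3:K) (1 - I)) x y, At S x y → x ≠ 0 → ∀ m, x = I * m ^ 2 → S ∈ HH P T := by
    intro S x y hS hx m hm
    exact hsq.addP hT hP hS hx (neg_ne_zero.2 hI0) (t := m) (by rw [hm]; linear_combination (-m ^ 2) * hI)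
  have hc : Cls x := by
    obtain ⟨d, r, hd, e⟩ := desc 3 ⟨1, -1⟩ x y hx (by rw [hS.eq, hA, hB]; ring)
    have h1 := cls_of_dvd d 1 (hd.trans ⟨⟨0, 1⟩, by ext <;> decide⟩)
    rw [e]
    apply h1.mulsq
    rintro rfl; simp at e; exact hx e
  have hbl : 1 - I = -I * l := by unfold l; linear_combination hI
  obtain ⟨m, hm, h | h | h | h⟩ := hc
  · subst h; exact hsq _ _ _ hm hS
  · exact claimI _ _ _ hS hx m h
  · apply addT hT hS hx
    intro S y hS
    refine claimI _ _ _ hS (div_ne_zero hb hx) (I / m) ?_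
    have := V_l.ne
    rw [h, hbl]; field_simp; linear_combination -hI
  · refine hsq.addT hb hT hS hx (t := l * m) ?_
    rw [h, hbl]; linear_combination (-l ^ 2 * m ^ 2) * hI

/-! ε = I -/
theorem MWI {P T : Pt (3 * I) (-1 + I)} (hP : At P (-1) (1 + I)) (hT : At T 0 0)
    (S : Pt (3 * I) (-1 + I)) : S ∈ HH P T := by
  have hI0 := V_I.ne
  have hl0 := V_l.ne
  have hbl : -1 + I = I * l := by unfold l; linear_combination -hI
  have hb : -1 + I ≠ 0 := by rw [hbl]; exact mul_ne_zero hI0 hl0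
  have hB : algebraMap ZI K ⟨-1, 1⟩ = -1 + I := by
    have h2 : (⟨-1, 1⟩ : ZI) = -(1 : ZI) + ⟨0, 1⟩ := by ext <;> simp
    rw [h2, map_add, map_neg, map_one]; rfl
  have hA : algebraMap ZI K ⟨0, 3⟩ = 3 * I := by
    have h2 : (⟨0, 3⟩ : ZI) = (3 : ZI) * ⟨0, 1⟩ := by ext <;> simp
    rw [h2, map_mul, map_ofNat]; rfl
  have hd' : (3 * I) ^ 2 - 4 * (-1 + I) = -(5 + 4 * I) := by linear_combination 9 * hI
  have hd : (3 * I) ^ 2 - 4 * (-1 + I) ≠ 0 := by rw [hd']; exact V_pz.neg.ne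
  have hP' : At P (I ^ 2) (I * (1 - I)) := by
    rw [hI, show I * (1 - I) = 1 + I by linear_combination -hI]; exact hP
  have hsq : SqIn P T := by
    apply kclass ⟨0, 3⟩ ⟨-1, 1⟩ 0 I hI0 ⟨-1, by ext <;> decide⟩ hA.symm hB.symm
      (by rw [pz_map, hI]; linear_combination 9 * hI)
    intro S r s k N hr hS hk hk0 hN hc
    rw [hd'] at hN
    obtain ⟨m, hm, h | h | h | h⟩ := hc
    · obtain ⟨S', hS'⟩ := hS.halve hb hd hr (m := m) (by rw [← hk, h])
      rw [hS']; exact HH.dbl _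
    · refine addPk hb hd hT hS hP' hr hI0 (t := I * m) ?_ (mul_ne_zero hI0 hm)
      rw [← hk, h]; linear_combination (2 * I * m ^ 2) * hI
    · exfalso
      obtain ⟨j, hj⟩ := exV hm
      have hv := V_l.mul hj.sq
      rw [← h] at hv
      exact oddExcl (V_3.mul V_I).d hv (by omega) V_pz.neg hN
    · exfalso
      obtain ⟨j, hj⟩ := exV hm
      have hv := (V_I.mul V_l).mul hj.sq
      rw [← h] at hv
      exact oddExcl (V_3.mul V_I).d hv (by omega) V_pz.neg hN
  by_cases hS0 : S = 0
  · rw [hS0]; exact zero_mem _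
  obtain ⟨x, y, hS⟩ := ex_At hS0
  by_cases hx : x = 0
  · subst hx; rw [hS.T hT]; exact HH.T
  have claimI : ∀ (S : Pt (3 * I) (-1 + I)) x y, At S x y → ∀ m, m ≠ 0 → x = I * m ^ 2 → S ∈ HH P T := by
    intro S x y hS m hm hx
    exfalso
    have h1 := hS.eq
    rw [hx] at h1
    apply X2 hm (N := y / m)
    rw [div_pow, h1, hbl]
    field_simp
    linear_combination (-I * m ^ 4 - 3 * I * m ^ 2 - l) * hI
  have hc : Cls x := by
    obtain ⟨d, r, hd, e⟩ := desc ⟨0, 3⟩ ⟨-1, 1⟩ x y hx (by rw [hS.eq, hA, hB]; ring)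
    have h1 := cls_of_dvd d 1 (hd.trans ⟨⟨0, -1⟩, by ext <;> decide⟩)
    rw [e]
    apply h1.mulsq
    rintro rfl; simp at e; exact hx e
  obtain ⟨m, hm, h | h | h | h⟩ := hc
  · subst h; exact hsq _ _ _ hm hS
  · exact claimI _ _ _ hS m hm h
  · apply addT hT hS hx
    intro S y hS
    refine claimI _ _ _ hS (1 / m) (div_ne_zero one_ne_zero hm) ?_
    rw [h, hbl]; field_simp
  · refine hsq.addT hb hT hS hx (t := I * l * m) ?_
    rw [h, hbl]; ring

/-! ε = λ -/
theorem MWl {P T : Pt (3 * l) (2 * l)} (hP : At P (-l) (2 * I)) (hT : At T 0 0)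
    (S : Pt (3 * l) (2 * l)) : S ∈ HH P T := by
  have hI0 := V_I.ne
  have hl0 := V_l.ne
  have hb : 2 * l ≠ 0 := mul_ne_zero V_2.ne hl0
  have hB : algebraMap ZI K ⟨2, 2⟩ = 2 * l := by
    have h2 : (⟨2, 2⟩ : ZI) = (2 : ZI) * lam := by ext <;> simp [lam]
    rw [h2, map_mul, map_ofNat, lam_map]
  have hA : algebraMap ZI K ⟨3, 3⟩ = 3 * l := by
    have h2 : (⟨3, 3⟩ : ZI) = (3 : ZI) * lam := by ext <;> simp [lam]
    rw [h2, map_mul, map_ofNat, lam_map]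
  have hd' : (3 * l) ^ 2 - 4 * (2 * l) = l ^ 2 * (5 + 4 * I) := by
    unfold l; linear_combination (-4 - 4 * I) * hI
  have hd : (3 * l) ^ 2 - 4 * (2 * l) ≠ 0 := by rw [hd']; exact (V_l.sq.mul V_pz).ne
  have hsq : SqIn P T := by
    apply kclass ⟨3, 3⟩ ⟨2, 2⟩ 2 l hl0 ⟨1, by ext <;> decide⟩ hA.symm hB.symm
      (by rw [pz_map, hd']; ring)
    intro S r s k N hr hS hk hk0 hN hc
    rw [hd'] at hN
    obtain ⟨m, hm, h | h | h | h⟩ := hc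
    · obtain ⟨S', hS'⟩ := hS.halve hb hd hr (m := m) (by rw [← hk, h])
      rw [hS']; exact HH.dbl _
    · exfalso
      rw [h] at hN
      exact X3 hm (N := N) (by rw [← hN]; ring)
    · exfalso
      rw [h] at hN
      exact X4 hm (N := N) (by rw [← hN]; ring)
    · exfalso
      rw [h] at hN
      exact X5 hm (N := N) (by rw [← hN]; ring)
  by_cases hS0 : S = 0
  · rw [hS0]; exact zero_mem _
  obtain ⟨x, y, hS⟩ := ex_At hS0
  by_cases hx : x = 0
  · subst hx; rw [hS.T hT]; exact HH.T
  have claimI : ∀ (S : Pt (3 * l) (2 * l)) x y, At S x y → x ≠ 0 → ∀ m, x = l * m ^ 2 → S ∈ HH P T := by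
    intro S x y hS hx m hm
    exact hsq.addP hT hP hS hx (neg_ne_zero.2 hl0) (t := I * l * m)
      (by rw [hm]; linear_combination (-l ^ 2 * m ^ 2) * hI)
  have hc : Cls x := by
    obtain ⟨d, r, hd, e⟩ := desc ⟨3, 3⟩ ⟨2, 2⟩ x y hx (by rw [hS.eq, hA, hB]; ring)
    have h1 := cls_of_dvd d 3 (hd.trans ⟨⟨0, 1⟩, by ext <;> decide⟩)
    rw [e]
    apply h1.mulsq
    rintro rfl; simp at e; exact hx e
  obtain ⟨m, hm, h | h | h | h⟩ := hc
  · subst h; exact hsq _ _ _ hm hS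
  · apply addT hT hS hx
    intro S y hS
    refine claimI _ _ _ hS (div_ne_zero hb hx) (I * l / m) ?_
    rw [h, div_pow, mul_pow, hl2]; field_simp; linear_combination (1 - I ^ 2) * hI
  · exact claimI _ _ _ hS hx m h
  · refine hsq.addT hb hT hS hx (t := l ^ 2 * m) ?_
    rw [h]; linear_combination (-l ^ 2 * m ^ 2) * hl2
end
end N3M3

namespace N3M3
noncomputable section
variable {a b : K}

theorem dblx {S : Pt a b} (h : S + S ≠ 0) : ∃ x y y', At S x y ∧ y ≠ 0 ∧
    At (S + S) (((x ^ 2 - b) / (2 * y)) ^ 2) y' := by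
  have h0 : S ≠ 0 := by rintro rfl; simp at h
  obtain ⟨x, y, hS⟩ := ex_At h0
  have hy : y ≠ 0 := by rintro rfl; exact h hS.dbl0
  obtain ⟨y', h'⟩ := hS.dbl hy
  exact ⟨x, y, y', hS, hy, h'⟩

theorem V.of_sq_ge {k m : ℤ} {y : K} (h : V k y) (h' : D m (y ^ 2)) : m ≤ 2 * k := h.sq.le_of_D h'

/-- valuation of doubles when `v(x) < 0` -/
theorem dbl_neg (ha : D 0 a) (hb : D 0 b) {x y : K} {n k : ℤ} (hx : V n x) (hy : V k y) (hn : n < 0)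
    (h : y ^ 2 = x ^ 3 + a * x ^ 2 + b * x) : V (n - 4) (((x ^ 2 - b) / (2 * y)) ^ 2) ∧ n % 2 = 0 := by
  have h1 : V (3 * n) (y ^ 2) := by
    rw [h]
    have h3 := hx.pow 3
    have h2 := (h3.addD (ha.mul hx.sq.d) (by push_cast; omega)).addD (hb.mul hx.d) (by push_cast; omega)
    exact_mod_cast h2
  have h2 := hy.sq.uniq h1
  have h3 := hx.sq.subD hb (by omega)
  have h4 := (h3.div (V_2.mul hy)).sq
  have e : 2 * (2 * n - (2 + k)) = n - 4 := by omega
  rw [e] at h4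
  exact ⟨h4, by omega⟩

theorem L2A (ha : V 0 a) (hb : V 1 b) (S : Pt a b) (x' y' : K) (j : ℤ) (h : At (S + S) x' y')
    (hj : V j x') : j ≤ -6 := by
  obtain ⟨x, y, y'', hS, hy, h2⟩ := dblx h.ne0
  obtain rfl := (h.uniq h2).1
  obtain ⟨k, hk⟩ := exV hy
  have heq := hS.eq
  have heq' : y ^ 2 = x * (x * (x + a) + b) := by rw [heq]; ring
  have hb0 : D 0 b := hb.d.mono (by norm_num)
  by_cases hx0 : x = 0
  · exfalso; subst hx0; apply hy
    have : y ^ 2 = 0 := by rw [heq]; ring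
    simpa using this
  obtain ⟨n, hn⟩ := exV hx0
  rcases lt_trichotomy n 0 with h3 | rfl | h3
  · obtain ⟨h4, h5⟩ := dbl_neg ha.d hb0 hn hk h3 heq
    have := hj.uniq h4; omega
  · have h4 : D 1 (y ^ 2) := by
      rw [heq']
      have h5 : D 1 (x + a) := by
        have := (hn.res.add ha.res).add (V_2.d.mono (show (1:ℤ) ≤ 2 by norm_num))
        convert this using 1; ring
      exact hn.d.mul (((hn.d.mul h5).mono (by norm_num)).add hb.d)
    have h5 := hk.of_sq_ge h4
    have h6 := hj.uniq (((hn.sq.subD hb.d (by norm_num)).div (V_2.mul hk)).sq)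
    omega
  · have h4 : D 3 (y ^ 2) := by
      rw [heq']
      rcases eq_or_ne n 1 with rfl | h5
      · have h6 : D 2 (x * (x + a) + b) := by
          have h7 := (hn.mul ha).near_l.sub hb.neg.near_l
          have := h7.add hn.sq.d
          convert this using 1; ring
        exact hn.d.mul h6
      · have h6 : D 1 (x * (x + a) + b) := by
          have : D 0 (x + a) := (hn.d.mono (by omega)).add ha.d
          exact ((hn.d.mul this).mono (by omega)).add hb.d
        exact (hn.d.mul h6).mono (by omega)
    have h5 := hk.of_sq_ge h4
    have h6 : V 1 (x ^ 2 - b) := by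
      have := hb.neg.addD hn.sq.d (by omega)
      convert this using 1; ring
    have h7 := hj.uniq ((h6.div (V_2.mul hk)).sq)
    omega

theorem L2B (ha : V 1 a) (hb : V 3 b) (S : Pt a b) (x' y' : K) (j : ℤ) (h : At (S + S) x' y')
    (hj : V j x') : j ≤ -4 := by
  obtain ⟨x, y, y'', hS, hy, h2⟩ := dblx h.ne0
  obtain rfl := (h.uniq h2).1
  obtain ⟨k, hk⟩ := exV hy
  have heq := hS.eq
  have heq' : y ^ 2 = x * (x * (x + a) + b) := by rw [heq]; ring
  have hb0 : D 0 b := hb.d.mono (by norm_num)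
  have ha0 : D 0 a := ha.d.mono (by norm_num)
  by_cases hx0 : x = 0
  · exfalso; subst hx0; apply hy
    have : y ^ 2 = 0 := by rw [heq]; ring
    simpa using this
  obtain ⟨n, hn⟩ := exV hx0
  rcases lt_trichotomy n 0 with h3 | rfl | h3
  · obtain ⟨h4, h5⟩ := dbl_neg ha0 hb0 hn hk h3 heq
    have := hj.uniq h4; omega
  · have h4 : D 0 (y ^ 2) := by
      rw [heq']
      exact hn.d.mul ((hn.d.mul (hn.d.add ha0)).add hb0)
    have h5 := hk.of_sq_ge h4
    have h6 := hj.uniq (((hn.sq.subD hb.d (by norm_num)).div (V_2.mul hk)).sq)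
    omega
  · rcases eq_or_ne n 1 with rfl | h5
    · have h6 : D 3 (x * (x + a) + b) := by
        have h7 := hn.near_l.sub ha.neg.near_l
        have h8 := (hn.d.mul h7).add hb.d
        have e9 : x * (x + a) + b = x * (x - l - (-a - l)) + b := by ring
        rw [e9]; exact h8
      have h5 := hk.of_sq_ge (y := y) (by rw [heq']; exact hn.d.mul h6)
      have h7 := hj.uniq (((hn.sq.subD hb.d (by norm_num)).div (V_2.mul hk)).sq)
      omega
    · have h6 : D 3 (x * (x + a) + b) := by
        have : D 1 (x + a) := (hn.d.mono (by omega)).add ha.d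
        exact ((hn.d.mul this).mono (by omega)).add hb.d
      have h5 := hk.of_sq_ge (y := y) (by rw [heq']; exact hn.d.mul h6)
      have h6 : V 3 (x ^ 2 - b) := by
        have := hb.neg.addD hn.sq.d (by omega)
        convert this using 1; ring
      have h7 := hj.uniq ((h6.div (V_2.mul hk)).sq)
      omega

theorem yv (ha : D 0 a) (hb : D 0 b) {Q : Pt a b} {x y : K} {j : ℤ} (h : At Q x y) (hj : V j x) (hj4 : j ≤ -4) :
    ∃ i, j = 2 * i ∧ V (3 * i) y ∧ E (y ^ 2 / x ^ 3) := by
  have hx := hj.ne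
  have e : y ^ 2 / x ^ 3 = 1 + a / x + b / x ^ 2 := by
    rw [h.eq]; field_simp
  have hE : E (y ^ 2 / x ^ 3) := by
    rw [e]; unfold E
    rw [show 1 + a / x + b / x ^ 2 - 1 = a / x + b / x ^ 2 by ring]
    exact ((ha.divV hj).mono (by omega)).add ((hb.divV hj.sq).mono (by omega))
  have h1 : V (3 * j) (y ^ 2) := by
    have h2 := hE.v.mul (hj.pow 3)
    have e2 : y ^ 2 / x ^ 3 * x ^ 3 = y ^ 2 := by field_simp
    rw [e2] at h2
    simpa using h2
  obtain ⟨k, hk, hy⟩ := V_sq_even h1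
  obtain ⟨i, rfl⟩ : ∃ i, j = 2 * i := ⟨j / 2, by omega⟩
  obtain rfl : k = 3 * i := by omega
  exact ⟨i, rfl, hy, hE⟩

theorem L3a (ha : D 0 a) (hb : D 0 b) {Q : Pt a b} {x y : K} {j : ℤ} (h : At Q x y) (hj : V j x) (hj4 : j ≤ -4) :
    ∃ y' z, At (Q + Q) (x / 4 * z) y' ∧ E z := by
  obtain ⟨i, rfl, hy, hE⟩ := yv ha hb h hj hj4
  have hx := hj.ne
  have hy0 := hy.ne
  obtain ⟨y', h'⟩ := h.dbl hy.ne
  refine ⟨y', (1 - b / x ^ 2) ^ 2 / (y ^ 2 / x ^ 3), ?_, ?_⟩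
  · convert h' using 1
    field_simp
    norm_num
    ring
  · refine (E_sq ?_).div hE
    rw [show 1 - b / x ^ 2 - 1 = -(b / x ^ 2) by ring]
    exact ((hb.divV hj.sq).mono (by omega)).neg

theorem L3b (ha : D 0 a) (hb : D 0 b) {Q1 Q2 : Pt a b} {x1 y1 x2 y2 : K} {j k : ℤ} (h1 : At Q1 x1 y1)
    (h2 : At Q2 x2 y2) (hj : V j x1) (hk : V k x2) (hj4 : j ≤ -4) (hk4 : k ≤ j - 4) :
    ∃ y z, At (Q1 + Q2) (x1 * z) y ∧ E z := by
  obtain ⟨i1, rfl, hy1, hE1⟩ := yv ha hb h1 hj hj4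
  obtain ⟨i2, rfl, hy2, hE2⟩ := yv ha hb h2 hk (by omega)
  have hx1 := hj.ne
  have hx2 := hk.ne
  have hy20 := hy2.ne
  have hne : x1 ≠ x2 := by
    rintro rfl; have := hj.uniq hk; omega
  have hs : x1 - x2 ≠ 0 := sub_ne_zero.2 hne
  obtain ⟨y3, h3⟩ := h1.add' h2 hne hx1 hx2
  have hE3 : E ((1 - x1 / x2) ^ 2) := by
    apply E_sq
    rw [show 1 - x1 / x2 - 1 = -(x1 / x2) by ring]
    exact ((hj.div hk).d.mono (by omega)).neg
  have h12 : 1 - x1 / x2 ≠ 0 := by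
    intro h; apply hE3.v.ne; rw [h]; ring
  refine ⟨y3, (y2 ^ 2 / x2 ^ 3) * (1 - y1 * x2 / (y2 * x1)) ^ 2 / (1 - x1 / x2) ^ 2, ?_, ?_⟩
  · convert h3 using 1
    have e1 : 1 - x1 / x2 = -(x1 - x2) / x2 := by field_simp; ring
    have e2 : 1 - y1 * x2 / (y2 * x1) = -(y1 * x2 - y2 * x1) / (y2 * x1) := by field_simp; ring
    rw [e1, e2]
    field_simp
  · refine (hE2.mul (E_sq ?_)).div hE3
    rw [show 1 - y1 * x2 / (y2 * x1) - 1 = -(y1 * x2 / (y2 * x1)) by ring]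
    exact (((hy1.mul hk).div (hy2.mul hj)).d.mono (by omega)).neg

theorem vdbl (ha : D 0 a) (hb : D 0 b) {c : ℤ} (hc : 4 ≤ c) {Q : Pt a b}
    (hQ : ∀ x y j, At Q x y → V j x → j ≤ -c) :
    ∀ x y j, At (Q + Q) x y → V j x → j ≤ -(c + 4) := by
  intro x y j h hj
  have h0 : Q ≠ 0 := by rintro rfl; simp at h; exact h.ne0 rfl
  obtain ⟨x1, y1, h1⟩ := ex_At h0
  have hx1 : x1 ≠ 0 := by
    rintro rfl
    have : y1 = 0 := by
      have := h1.eq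
      have : y1 ^ 2 = 0 := by rw [this]; ring
      simpa using this
    subst this
    exact h.ne0 h1.dbl0
  obtain ⟨i, hi⟩ := exV hx1
  have h2 := hQ _ _ _ h1 hi
  obtain ⟨y', z, h3, hz⟩ := L3a ha hb h1 hi (by omega)
  have h4 := (h.uniq h3).1
  rw [h4] at hj
  have := hj.uniq ((hi.div V_4).mul hz.v)
  omega
end
end N3M3

namespace N3M3
noncomputable section
variable {a b : K}

abbrev four (S : Pt a b) : Pt a b := (S + S) + (S + S)

theorem L4 (ha : D 0 a) (hb : D 0 b) {P T : Pt a b} (hL1 : ∀ S, S ∈ HH P T) (hT : At T 0 0)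
    {c ns : ℤ} (hc : 4 ≤ c) (hL2 : ∀ (S : Pt a b) x y j, At (S + S) x y → V j x → j ≤ -c)
    {Xs Ys : K} (hX : At (four P) Xs Ys) (hns : V ns Xs) (hcn : -c - 8 ≤ ns) (hns8 : ns ≤ -8) :
    ∀ (N : ℕ) (S : Pt a b) (x y : K) (j : ℤ), At (four S) x y → V j x → -j ≤ N →
      ∃ (k : ℕ) (z : K), E z ∧ x = Xs / 4 ^ k * z := by
  have h4 : ∀ S : Pt a b, ∀ x y j, At (four S) x y → V j x → j ≤ -(c + 4) := fun S =>
    vdbl ha hb hc (hL2 S)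
  have h16 : ∀ S : Pt a b, ∀ x y j, At (four S + four S + (four S + four S)) x y → V j x →
      j ≤ -(c + 4 + 4 + 4) := fun S =>
    vdbl ha hb (by omega) (vdbl ha hb (by omega) (h4 S))
  have hT2 : T + T = 0 := hT.dbl0
  intro N
  induction N with
  | zero =>
    intro S x y j h hj hN
    have := h4 S x y j h hj
    push_cast at hN
    omega
  | succ N ih =>
    intro S x y j h hj hN
    have case1 : ∀ S' : Pt a b, four S = four S' + four S' →
        ∃ (k : ℕ) (z : K), E z ∧ x = Xs / 4 ^ k * z := by
      intro S' e
      have h0 : four S' ≠ 0 := by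
        intro h0; rw [h0, add_zero] at e; exact h.ne0 e
      obtain ⟨x1, y1, h1⟩ := ex_At h0
      have hx1 : x1 ≠ 0 := by
        rintro rfl
        have := h1.T hT
        rw [this, hT2] at e; exact h.ne0 e
      obtain ⟨i, hi⟩ := exV hx1
      have h2 := h4 _ _ _ _ h1 hi
      obtain ⟨y', z, h3, hz⟩ := L3a ha hb h1 hi (by omega)
      rw [← e] at h3
      have h5 := (h.uniq h3).1
      have h6 := hj.uniq (by rw [h5]; exact (hi.div V_4).mul hz.v)
      obtain ⟨k, z', hz', e'⟩ := ih S' x1 y1 i h1 hi (by push_cast at hN; omega)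
      refine ⟨k + 1, z' * z, hz'.mul hz, ?_⟩
      rw [h5, e', pow_succ]
      have := V_4.ne
      field_simp
    have case2 : ∀ (P4 : Pt a b) (Ys : K), At P4 Xs Ys → ∀ S' : Pt a b, four S = P4 + (four S' + four S' + (four S' + four S')) →
        ∃ (k : ℕ) (z : K), E z ∧ x = Xs / 4 ^ k * z := by
      intro P4 Ys hX S' e
      by_cases h0 : four S' + four S' + (four S' + four S') = 0
      · rw [h0, add_zero] at e
        rw [e] at h
        exact ⟨0, 1, E_one, by rw [(h.uniq hX).1]; ring⟩
      · obtain ⟨x1, y1, h1⟩ := ex_At h0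
        have hx1 : x1 ≠ 0 := by
          rintro rfl
          have h2 := h1.T hT
          rw [h2] at e
          have h5 := h4 S x y j h hj
          obtain ⟨y', h6⟩ := hX.addT hT hns.ne
          rw [e] at h
          have h7 := (h.uniq h6).1
          have h8 : D 0 x := by
            rw [h7]; exact (hb.divV hns).mono (by omega)
          have := hj.le_of_D h8
          omega
        obtain ⟨i, hi⟩ := exV hx1
        have h2 := h16 _ _ _ _ h1 hi
        obtain ⟨y', z, h3, hz⟩ := L3b ha hb hX h1 hns hi (by omega) (by omega)
        rw [← e] at h3
        exact ⟨0, z, hz, by rw [(h.uniq h3).1]; ring⟩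
    have case3 : ∀ S1 : Pt a b, four S = four P + (four S1 + four S1) →
        ∃ (k : ℕ) (z : K), E z ∧ x = Xs / 4 ^ k * z := by
      intro S1 e'
      obtain ⟨S2, f | f | f | f⟩ := HH.cases (hL1 S1)
      · apply case2 _ _ hX S2
        rw [e', f]
      · apply case2 _ _ hX S2
        rw [e', f]
        calc four P + (four (T + (S2 + S2)) + four (T + (S2 + S2))) =
              four P + (four S2 + four S2 + (four S2 + four S2)) + four (T + T) := by
                simp only [four]; abel
          _ = _ := by rw [hT2]; simp only [four]; abel
      · apply case2 _ _ hX.neg (S2 + P)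
        rw [e', f]
        simp only [four]; abel
      · apply case2 _ _ hX.neg (S2 + P)
        rw [e', f]
        calc four P + (four (P + T + (S2 + S2)) + four (P + T + (S2 + S2))) =
              -four P + (four (S2 + P) + four (S2 + P) + (four (S2 + P) + four (S2 + P))) + four (T + T) := by
                simp only [four]; abel
          _ = _ := by rw [hT2]; simp only [four]; abel
    obtain ⟨S1, e | e | e | e⟩ := HH.cases (hL1 S)
    · apply case1 S1; rw [e]
    · apply case1 S1
      rw [e]
      calc four (T + (S1 + S1)) = (T + T) + (T + T) + (four S1 + four S1) := by
            simp only [four]; abel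
        _ = _ := by rw [hT2]; abel
    · exact case3 S1 (by rw [e]; simp only [four]; abel)
    · apply case3 S1
      rw [e]
      calc four (P + T + (S1 + S1)) = four P + ((T + T) + (T + T)) + (four S1 + four S1) := by
            simp only [four]; abel
        _ = _ := by rw [hT2]; abel

theorem G (ha : D 0 a) (hb : D 0 b) {P T : Pt a b} (hL1 : ∀ S, S ∈ HH P T) (hT : At T 0 0)
    {c ns : ℤ} (hc : 4 ≤ c) (hL2 : ∀ (S : Pt a b) x y j, At (S + S) x y → V j x → j ≤ -c)
    {Xs Ys : K} (hX : At (four P) Xs Ys) (hns : V ns Xs) (hcn : -c - 8 ≤ ns) (hns8 : ns ≤ -8)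
    {x0 y0 : K} (hP : At P x0 y0) {e f g h : ℤ} (hx0 : V e x0) (he : 0 ≤ e) (hf : V f b)
    (hef : (f - e - e) % 2 = 1) (hfe : e < f + 4) (hg : V g y0)
    (hh : D h (3 * x0 ^ 2 + 2 * a * x0 + b)) (hn1 : 2 * (4 + g - h) ≤ -ns) (hn2 : 2 * (4 + g) ≤ -3 * ns)
    {R : Pt a b} {x y : K} (hR : At R x y) (hx : V e x) :
    x = x0 ∨ ∃ (k : ℕ) (z : K), E z ∧ (x - x0) ^ 2 = 4 * y0 ^ 2 / Xs * 4 ^ k * z := by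
  have hT2 : T + T = 0 := hT.dbl0
  -- the key case
  have key : ∀ (R' S : Pt a b) (y : K), At R' x y → R' = P + four S →
      x = x0 ∨ ∃ (k : ℕ) (z : K), E z ∧ (x - x0) ^ 2 = 4 * y0 ^ 2 / Xs * 4 ^ k * z := by
    intro R' S y hR hRS
    by_cases h0 : four S = 0
    · left
      rw [h0, add_zero] at hRS
      rw [hRS] at hR
      exact (hR.uniq hP).1
    right
    obtain ⟨X, Y, hQ⟩ := ex_At h0
    have hX0 : X ≠ 0 := by
      rintro rfl
      have h2 := hQ.T hT
      rw [hRS, h2] at hR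
      obtain ⟨y', h3⟩ := hP.addT hT hx0.ne
      have h4 := (hR.uniq h3).1
      rw [h4] at hx
      have := hx.uniq (hf.div hx0)
      omega
    obtain ⟨j, hj⟩ := exV hX0
    obtain ⟨k, z, hz, hk⟩ := L4 ha hb hL1 hT hc hL2 hX hns hcn hns8 (-j).toNat S X Y j hQ hj (by omega)
    have hjn : j ≤ ns := by
      have h1 := (hns.div (V_4.pow k)).mul hz.v
      rw [← hk] at h1
      have := hj.uniq h1
      have : (0:ℤ) ≤ k := by positivity
      omega
    obtain ⟨i, rfl, hY, hE⟩ := yv ha hb hQ hj (by omega)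
    have hne : x0 ≠ X := by rintro rfl; have := hj.uniq hx0; omega
    have hs : x0 - X ≠ 0 := sub_ne_zero.2 hne
    have hsum := hP.add hQ hne
    rw [← hRS] at hsum
    have hxx := (hR.uniq hsum).1
    have hy0 := hg.ne
    have hY0 := hY.ne
    have hVXs := hns.ne
    have h40 := V_4.ne
    have hz0 := hz.v.ne
    set c1 := 3 * x0 ^ 2 + 2 * a * x0 + b with hc1
    set c0 := x0 * (b - x0 ^ 2) with hc0
    have hDc0 : D 0 c0 := by
      rw [hc0]
      exact (hx0.d.mul (hb.sub (hx0.sq.d.mono (by omega)))).mono (by omega)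
    have hE2 : E ((1 - c1 * X / (2 * y0 * Y) - c0 / (2 * y0 * Y)) ^ 2) := by
      apply E_sq
      rw [show 1 - c1 * X / (2 * y0 * Y) - c0 / (2 * y0 * Y) - 1 =
        -(c1 * X / (2 * y0 * Y)) - c0 / (2 * y0 * Y) by ring]
      have hden := (V_2.mul hg).mul hY
      exact (((hh.mul hj.d).divV hden).mono (by omega)).neg.sub ((hDc0.divV hden).mono (by omega))
    have hE3 : E ((1 - x0 / X) ^ 2) := by
      apply E_sq
      rw [show 1 - x0 / X - 1 = -(x0 / X) by ring]
      exact ((hx0.div hj).d.mono (by omega)).neg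
    refine ⟨k, z⁻¹ * ((Y ^ 2 / X ^ 3) * (1 - c1 * X / (2 * y0 * Y) - c0 / (2 * y0 * Y)) ^ 2 /
      ((1 - x0 / X) ^ 2 * (1 - x0 / X) ^ 2)), hz.inv.mul ((hE.mul hE2).div (hE3.mul hE3)), ?_⟩
    have e0 : ∀ B : K, 4 * y0 ^ 2 / Xs * 4 ^ k * (z⁻¹ * B) = 4 * y0 ^ 2 / X * B := by
      intro B
      rw [hk]
      field_simp
    rw [e0]
    have e2 : x - x0 = (-2 * y0 * Y + c1 * X + c0) / (x0 - X) ^ 2 := by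
      rw [hxx, hc1, hc0]
      field_simp
      linear_combination hP.eq + hQ.eq
    have e3 : 1 - x0 / X = -(x0 - X) / X := by field_simp; ring
    have e4 : 1 - c1 * X / (2 * y0 * Y) - c0 / (2 * y0 * Y) =
        -(-2 * y0 * Y + c1 * X + c0) / (2 * y0 * Y) := by field_simp; ring
    rw [e2, e3, e4]
    field_simp
    norm_num
    ring
  have hxne := hx.ne
  obtain ⟨S, hS | hS | hS | hS⟩ := HH.cases (hL1 R)
  · exfalso
    rw [hS] at hR
    have := hL2 _ _ _ _ hR hx
    omega
  · exfalso
    by_cases h0 : S + S = 0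
    · rw [h0, add_zero] at hS
      rw [hS] at hR
      exact hxne (hR.uniq hT).1
    · obtain ⟨X, Y, hQ⟩ := ex_At h0
      by_cases hX0 : X = 0
      · subst hX0
        have := hQ.T hT
        rw [hS, this, hT2] at hR
        exact hR.ne0 rfl
      obtain ⟨j, hj⟩ := exV hX0
      have h1 := hL2 _ _ _ _ hQ hj
      obtain ⟨y', h2⟩ := hQ.addT hT hX0
      rw [hS, add_comm] at hR
      have h3 := (hR.uniq h2).1
      have := hx.uniq (by rw [h3]; exact hf.div hj)
      omega
  · have hS' : ∃ S2 : Pt a b, S + S = four S2 ∨ S + S = P + P + four S2 := by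
      obtain ⟨S2, f | f | f | f⟩ := HH.cases (hL1 S)
      · exact ⟨S2, Or.inl (by rw [f])⟩
      · refine ⟨S2, Or.inl ?_⟩
        rw [f]
        calc _ = T + T + four S2 := by simp only [four]; abel
          _ = _ := by rw [hT2, zero_add]
      · exact ⟨S2, Or.inr (by rw [f]; simp only [four]; abel)⟩
      · refine ⟨S2, Or.inr ?_⟩
        rw [f]
        calc _ = T + T + (P + P + four S2) := by simp only [four]; abel
          _ = _ := by rw [hT2, zero_add]
    obtain ⟨S2, h2 | h2⟩ := hS'
    · exact key R S2 y hR (by rw [hS, h2])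
    · refine key (-R) (-(S2 + P)) (-y) hR.neg ?_
      rw [hS, h2]; simp only [four]; abel
  · exfalso
    -- X(P + 2 S) x0 is a square
    have hQ : ∃ (X Y w : K), At (P + (S + S)) X Y ∧ X * x0 = w ^ 2 ∧ X ≠ 0 := by
      by_cases h0 : S + S = 0
      · exact ⟨x0, y0, x0, by rw [h0, add_zero]; exact hP, by ring, hx0.ne⟩
      obtain ⟨x1, y1, y2, h1, hy1, h2⟩ := dblx h0
      have hw0 : (x1 ^ 2 - b) / (2 * y1) ≠ 0 := by
        intro h3
        have h4 : x1 ^ 2 - b = 0 := by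
          have h22 := V_2.ne
          rcases div_eq_zero_iff.1 h3 with h5 | h5
          · exact h5
          · exact absurd h5 (mul_ne_zero h22 hy1)
        rw [← sub_eq_zero.1 h4] at hf
        obtain ⟨i, hi, -⟩ := V_sq_even hf
        omega
      set w0 := (x1 ^ 2 - b) / (2 * y1) with hw0'
      obtain ⟨j, hj⟩ := exV (pow_ne_zero 2 hw0)
      have h3 := hL2 _ _ _ _ h2 hj
      have hne : x0 ≠ w0 ^ 2 := by
        intro h4
        rw [← h4] at hj
        have := hj.uniq hx0
        omega
      have hx00 := hx0.ne
      obtain ⟨y3, h4⟩ := hP.add' h2 hne hx00 (pow_ne_zero 2 hw0)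
      refine ⟨_, y3, (y0 * w0 ^ 2 - y2 * x0) / (x0 - w0 ^ 2) / w0, h4, ?_, ?_⟩
      · have := sub_ne_zero.2 hne
        field_simp
      · intro h5
        rw [h5] at h4
        have h6 := h4.T hT
        have : R = T + T := by
          calc R = (P + (S + S)) + T := by rw [hS]; abel
            _ = T + T := by rw [h6]
        rw [this, hT2] at hR
        exact hR.ne0 rfl
    obtain ⟨X, Y, w, hQ, hw, hX0⟩ := hQ
    obtain ⟨y', h2⟩ := hQ.addT hT hX0
    rw [show P + (S + S) + T = R by rw [hS]; abel] at h2
    have h3 := (hR.uniq h2).1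
    obtain ⟨j, hj⟩ := exV hX0
    have h4 := hx.uniq (by rw [h3]; exact hf.div hj)
    have h5 := hj.mul hx0
    rw [hw] at h5
    obtain ⟨i, hi, -⟩ := V_sq_even h5
    omega
end
end N3M3

namespace N3M3
noncomputable section
variable {a b : K}

theorem quad {P : Pt a b} {x0 y0 x2 y2 w w4 : K} (hP : At P x0 y0) (h0 : y0 ≠ 0) (h2 : y2 ≠ 0)
    (e1 : x0 ^ 2 - b = w * (2 * y0)) (e1' : w ^ 2 = x2) (e2 : y2 ^ 2 = x2 ^ 3 + a * x2 ^ 2 + b * x2)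
    (e3 : x2 ^ 2 - b = w4 * (2 * y2)) : ∃ Ys, At (four P) (w4 ^ 2) Ys := by
  have h22 := V_2.ne
  obtain ⟨y', h⟩ := hP.dbl h0
  have e : ((x0 ^ 2 - b) / (2 * y0)) ^ 2 = x2 := by
    rw [e1, mul_div_assoc, div_self (mul_ne_zero h22 h0), mul_one, e1']
  rw [e] at h
  have h3 := h.eq
  have hy : y' = y2 ∨ y' = -y2 := sq_eq_sq_iff_eq_or_eq_neg.1 (h3.trans e2.symm)
  have hy0 : y' ≠ 0 := by rcases hy with rfl | rfl <;> simpa using h2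
  obtain ⟨Ys, h4⟩ := h.dbl hy0
  refine ⟨Ys, ?_⟩
  convert h4 using 1
  rw [e3]
  rcases hy with rfl | rfl <;> field_simp

/-- structure of squares of nonzero rationals -/
theorem odd_E {m : ℤ} (h : m % 2 = 1) : E ((m : K) ^ 2) := by
  apply E_sq
  have : (m : K) - 1 = 2 * ((m / 2 : ℤ) : K) := by
    have h1 : m = 2 * (m / 2) + 1 := by omega
    have h2 : (m : K) = 2 * ((m / 2 : ℤ) : K) + 1 := by exact_mod_cast congrArg (Int.cast (R := K)) h1
    linear_combination h2
  rw [this]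
  simpa using V_2.d.mul (D_intC _)

theorem int_two {m : ℤ} (h : m ≠ 0) : ∃ (k : ℕ) (n : ℤ), m = 2 ^ k * n ∧ n % 2 = 1 := by
  obtain ⟨n, h1, h2⟩ := (FiniteMultiplicity.of_prime_left Int.prime_two h).exists_eq_pow_mul_and_not_dvd
  exact ⟨_, n, h1, by omega⟩

theorem rat_two {r : ℚ} (h : r ≠ 0) : ∃ (j : ℤ) (m n : ℤ), m % 2 = 1 ∧ n % 2 = 1 ∧
    (r : K) = 2 ^ j * (m / n) := by
  obtain ⟨k, m, h1, hm⟩ := int_two (Rat.num_ne_zero.2 h)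
  obtain ⟨k', n, h1', hn⟩ := int_two (m := (r.den : ℤ)) (by exact_mod_cast r.den_ne_zero)
  refine ⟨k - k', m, n, hm, hn, ?_⟩
  have h2 : (r : K) = (r.num : K) / ((r.den : ℤ) : K) := by
    push_cast; exact Rat.cast_def r
  have h22 := V_2.ne
  have hn0 := (V_odd n hn).ne
  rw [h2, h1, h1', zpow_sub₀ h22]
  push_cast
  rw [zpow_natCast, zpow_natCast]
  field_simp

theorem rat_v {r : ℚ} (h : r ≠ 0) : ∃ j : ℤ, V (2 * j) (r : K) ∧ ∃ z, E z ∧ (r : K) ^ 2 = 4 ^ j * z := by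
  obtain ⟨j, m, n, hm, hn, e⟩ := rat_two h
  refine ⟨j, ?_, ((m : K) ^ 2 / (n : K) ^ 2), (odd_E hm).div (odd_E hn), ?_⟩
  · rw [e]
    have := (V_2.zpow j).mul ((V_odd m hm).div (V_odd n hn))
    convert this using 1
    ring
  · rw [e, mul_pow, div_pow]
    congr 1
    rw [← zpow_natCast, ← zpow_mul, mul_comm, zpow_mul]; norm_num

theorem rat_unit {r : ℚ} (h : V 0 (r : K)) : (D 4 ((r : K) - 1) ∨ D 4 ((r : K) + 1)) ∧ D 6 ((r : K) ^ 2 - 1) := by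
  have h0 : r ≠ 0 := by rintro rfl; exact h.ne (by simp)
  obtain ⟨j, m, n, hm, hn, e⟩ := rat_two h0
  have hj : j = 0 := by
    have h1 := (V_2.zpow j).mul ((V_odd m hm).div (V_odd n hn))
    rw [← e] at h1
    have := h.uniq h1
    omega
  subst hj
  rw [zpow_zero, one_mul] at e
  have hN := V_odd n hn
  have hn0 := hN.ne
  have key : ∀ (s : ℤ) (q : ℤ), q * 4 = m - s * n → D 4 ((r : K) - s) := by
    intro s q hq
    have h1 : (r : K) - s = (q : K) * 4 / n := by
      have : (q : K) * 4 = m - s * n := by exact_mod_cast congrArg (Int.cast (R := K)) hq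
      rw [this, e]; field_simp
    rw [h1]
    simpa using ((D_intC q).mul V_4.d).divV hN
  constructor
  · have : m % 4 = n % 4 ∨ (m + n) % 4 = 0 := by omega
    rcases this with h1 | h1
    · left
      simpa using key 1 ((m - n) / 4) (by omega)
    · right
      simpa using key (-1) ((m + n) / 4) (by omega)
  · obtain ⟨q, hq⟩ : ∃ q, m ^ 2 - n ^ 2 = 8 * q := by
      have h1 := Int.eight_dvd_sq_sub_one_of_odd (Int.odd_iff.2 hm)
      have h2 := Int.eight_dvd_sq_sub_one_of_odd (Int.odd_iff.2 hn)
      have := dvd_sub h1 h2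
      obtain ⟨q, hq⟩ := this
      exact ⟨q, by linarith⟩
    have h1 : (r : K) ^ 2 - 1 = (q : K) * (2 * 4) / n ^ 2 := by
      have : (m : K) ^ 2 - n ^ 2 = 8 * q := by exact_mod_cast congrArg (Int.cast (R := K)) hq
      rw [e]; field_simp; linear_combination this
    rw [h1]
    simpa using ((D_intC q).mul (V_2.mul V_4).d).divV hN.sq

/-- minus a power of four is not in the class of a rational square -/
theorem no_neg {r : ℚ} (h : r ≠ 0) {m : ℤ} {z : K} (hz : E z) (e : (r : K) ^ 2 = -(4 ^ m * z)) : False := by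
  obtain ⟨j, -, z', hz', e'⟩ := rat_v h
  have h1 := (V_4.zpow j).mul hz'.v
  have h2 := ((V_4.zpow m).mul hz.v).neg
  rw [← e'] at h1
  rw [← e] at h2
  have hjm : j = m := by have := h1.uniq h2; omega
  subst hjm
  have h3 : z' = -z := by
    have := (V_4.zpow j).ne
    apply mul_left_cancel₀ this
    linear_combination e - e'
  have h4 : D 4 (2:K) := by
    unfold E at hz hz'
    rw [h3] at hz'
    have := (hz.add hz').neg
    convert this using 1; ring
  have := V_2.le_of_D h4
  omega

theorem no_odd {r : ℚ} (h : r ≠ 0) {m : ℤ} {z : K} (hz : E z) (e : (r : K) ^ 2 * (2 * I) = -(4 ^ m * z)) : False := by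
  obtain ⟨j, hj, -⟩ := rat_v h
  have h1 := hj.sq.mul (V_2.mul V_I)
  rw [e] at h1
  have := h1.uniq ((V_4.zpow m).mul hz.v).neg
  omega

theorem t_ne (t : ℚ) : (t : K) + I ≠ 0 ∧ (t : K) - I ≠ 0 := by
  have key : ∀ s : K, s ^ 2 = -1 → (t : K) ≠ s := by
    intro s hs h
    have h1 : (t : K) ^ 2 = -1 := by rw [h, hs]
    have h2 : t ^ 2 = -1 := by exact_mod_cast h1
    nlinarith [sq_nonneg t]
  constructor
  · intro h; exact key (-I) (by linear_combination hI) (by linear_combination h)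
  · intro h; exact key I hI (by linear_combination h)

def UU (t : ℚ) : K := I * (t + I) / (t - I)

theorem V_UU (t : ℚ) : V 0 (UU t) := by
  unfold UU
  have key : ∃ k, V k ((t : K) + I) ∧ V k ((t : K) - I) := by
    by_cases h : t = 0
    · subst h; exact ⟨0, by simpa using V_I, by simpa using V_I.neg⟩
    · obtain ⟨j, hj, -⟩ := rat_v h
      rcases lt_trichotomy j 0 with h1 | rfl | h1
      · exact ⟨_, hj.addD V_I.d (by omega), hj.subD V_I.d (by omega)⟩
      · have h2 : D 2 ((t : K) - 1) := by
          rcases (rat_unit (by simpa using hj)).1 with h3 | h3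
          · exact h3.mono (by norm_num)
          · have := (h3.mono (l := 2) (by norm_num)).sub V_2.d
            convert this using 1; ring
        refine ⟨1, ?_, ?_⟩
        · have := V_l.addD h2 (by norm_num)
          convert this using 1; unfold l; ring
        · have := V_1mI.addD h2 (by norm_num)
          convert this using 1; ring
      · refine ⟨0, ?_, ?_⟩
        · rw [add_comm]; exact V_I.addD hj.d (by omega)
        · have := V_I.neg.addD hj.d (by omega)
          convert this using 1; ring
  obtain ⟨k, h1, h2⟩ := key
  simpa using (V_I.mul h1).div h2

theorem E_negsq {u : K} (h : D 2 (u - I)) : E (-u ^ 2) := by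
  have : -u ^ 2 = (-I * u) ^ 2 := by linear_combination -(u ^ 2) * hI
  rw [this]
  apply E_sq
  have h2 := (V_I.neg.d.mul h).mono (l := 2) (by norm_num)
  convert h2 using 1
  linear_combination -hI

end
end N3M3

namespace N3M3
noncomputable section

theorem D_frac (m n d : ℤ) (hd : d % 2 = 1) : D 2 (2 * ((m : K) + n * I) / d) := by
  have h1 : D 0 ((m : K) + n * I) := by
    have := (D_intC n).mul V_I.d
    exact (D_intC m).add (by simpa using this)
  simpa using (V_2.d.mul h1).divV (V_odd d hd)

theorem C1 (t : ℚ) (Y : K) (h : Y ^ 2 = UU t ^ 3 + 3 * UU t ^ 2 + (1 - I) * UU t) : t = 0 := by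
  have hI' := hI
  have hI0 := V_I.ne
  have hb : (1 - I : K) ≠ 0 := V_1mI.ne
  have hd : (3:K) ^ 2 - 4 * (1 - I) ≠ 0 := by
    have : (3:K) ^ 2 - 4 * (1 - I) = 5 + 4 * I := by ring
    rw [this]; exact V_pz.ne
  obtain ⟨P, hP⟩ := mk_At hb hd (x := -I) (y := 2 * I) (by grind)
  obtain ⟨T, hT⟩ := mk_At hb hd (x := 0) (y := 0) (by ring)
  obtain ⟨R, hR⟩ := mk_At hb hd h
  have hz1 : E (-((9142 + 821 * I) / 685 : K) ^ 2) := by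
    apply E_negsq
    have := D_frac 4571 68 685 (by norm_num)
    convert this using 1
    push_cast; ring
  obtain ⟨Ys, hX⟩ := quad (x2 := -3 / 16 + I / 4) (y2 := 19 / 64 + 9 / 32 * I) (w := 1 / 4 + I / 2)
    (w4 := -821 / 5480 + 4571 / 2740 * I) hP (mul_ne_zero V_2.ne hI0)
    (by
      have := (V_unit 19 18 (by norm_num)).ne
      intro h; apply this; push_cast; linear_combination 64 * h)
    (by grind) (by grind) (by grind) (by grind)
  set z1 := (-((9142 + 821 * I) / 685 : K) ^ 2) with hz1d
  have hXs : (-821 / 5480 + 4571 / 2740 * I) ^ 2 = z1 / 64 := by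
    rw [hz1d]; grind
  rw [hXs] at hX
  have hns : V (-12) (z1 / 64) := by
    have := hz1.v.div (V_4.pow 3)
    norm_num at this; exact this
  have hU := V_UU t
  have ha : V 0 (3:K) := V_3
  obtain ⟨hp, hm⟩ := t_ne t
  have eU : UU t - -I = 2 * I * t / (t - I) := by
    unfold UU; field_simp; ring
  rcases G (c := 6) (e := 0) (f := 1) (g := 2) (h := 0) ha.d (V_1mI.d.mono (by norm_num)) (MW1 hP hT) hT (by norm_num)
    (L2A ha V_1mI) hX hns (by norm_num) (by norm_num) hP V_I.neg le_rfl V_1mI (by norm_num)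
    (by norm_num) (by simpa using V_2.mul V_I)
    (by
      have := (D_intC (-2)).sub ((D_intC 7).mul V_I.d)
      convert this using 1
      push_cast; grind) (by norm_num) (by norm_num) hR hU with h1 | ⟨k, z, hz, h1⟩
  · have h2 : UU t - -I = 0 := by rw [h1]; ring
    rw [eU] at h2
    have h3 := V_2.ne
    have : (t : K) = 0 := by simpa [h3, hI0, hm] using h2
    exact_mod_cast this
  · by_contra ht
    exfalso
    obtain ⟨j, hj, -⟩ := rat_v ht
    obtain ⟨i, hi⟩ := exV hm
    have v1 := (((V_2.mul V_I).mul hj).div hi).sq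
    rw [← eU, h1] at v1
    have v2 := (((V_4.mul (V_2.mul V_I).sq).div hns).mul (V_4.pow k)).mul hz.v
    have v3 := v1.uniq v2
    have hj1 : 1 ≤ j := by
      by_contra hj1
      have := hi.le_of_D (hj.d.sub (V_I.d.mono (l := 2 * j) (by omega)))
      omega
    have hz0 : E (-(I - t : K) ^ 2) := by
      apply E_negsq
      convert (hj.d.mono (l := 2) (by omega)).neg using 1
      ring
    set z0 := (-(I - t : K) ^ 2) with hz0d
    refine no_neg ht ((hz0.mul hz).div hz1) (m := k + 4) ?_
    have hz10 := hz1.v.ne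
    have h40 := V_4.ne
    rw [zpow_add₀ h40, zpow_natCast]
    rw [eU] at h1
    have h2 : (2 * I * t / (t - I) : K) ^ 2 * z0 = 4 * t ^ 2 := by
      rw [hz0d]; field_simp; grind
    have h5 : (t : K) ^ 2 = (2 * I * t / (t - I) : K) ^ 2 * z0 / 4 := by rw [h2]; field_simp
    rw [h5, h1]
    norm_num
    field_simp
    grind

theorem CI (t : ℚ) (Y : K) (h : Y ^ 2 = (I * UU t) ^ 3 + 3 * I * (I * UU t) ^ 2 + (-1 + I) * (I * UU t)) : False := by
  have hI' := hI
  have hI0 := V_I.ne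
  have Vb : V 1 (-1 + I) := by
    have := V_1mI.neg; convert this using 1; ring
  have hb := Vb.ne
  have hd : (3 * I) ^ 2 - 4 * (-1 + I) ≠ 0 := by
    have : (3 * I) ^ 2 - 4 * (-1 + I) = -(5 + 4 * I) := by grind
    rw [this]; exact V_pz.neg.ne
  obtain ⟨P, hP⟩ := mk_At hb hd (x := -1) (y := 1 + I) (by grind)
  obtain ⟨T, hT⟩ := mk_At hb hd (x := 0) (y := 0) (by ring)
  obtain ⟨R, hR⟩ := mk_At hb hd h
  have hz1 : E (-((146 - 737 * I) / 85 : K) ^ 2) := by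
    apply E_negsq
    have := D_frac 73 (-411) 85 (by norm_num)
    convert this using 1
    push_cast; ring
  obtain ⟨Ys, hX⟩ := quad (x2 := -1 / 2 - 3 / 8 * I) (y2 := 1 / 32 - 13 / 32 * I) (w := 1 / 4 - 3 / 4 * I)
    (w4 := 591 / 680 + 883 / 680 * I) hP (by exact V_l.ne)
    (by
      have := V_2.ne
      have h3 : (1 - 13 * I) = (1 - I) * (7 - 6 * I) := by grind
      have h4 := (V_unit 7 (-6) (by norm_num)).ne
      have h5 := V_1mI.ne
      intro h
      rcases mul_eq_zero.1 (h3.symm.trans (show 1 - 13 * I = 0 by linear_combination 32 * h)) with h6 | h6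
      · exact h5 h6
      · apply h4; push_cast; linear_combination h6)
    (by grind) (by grind) (by grind) (by grind)
  set z1 := (-((146 - 737 * I) / 85 : K) ^ 2) with hz1d
  have hXs : (591 / 680 + 883 / 680 * I) ^ 2 = z1 * I / 32 := by
    rw [hz1d]; grind
  rw [hXs] at hX
  have hns : V (-10) (z1 * I / 32) := by
    have := (hz1.v.mul V_I).div (V_2.pow 5)
    norm_num at this; exact this
  have hU := V_I.mul (V_UU t)
  have ha : V 0 (3 * I) := by simpa using V_3.mul V_I
  obtain ⟨hp, hm⟩ := t_ne t
  have eU : I * UU t - -1 = -2 * I / (t - I) := by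
    unfold UU; field_simp; grind
  rcases G (c := 6) (e := 0) (f := 1) (g := 1) (h := 0) ha.d (Vb.d.mono (by norm_num)) (MWI hP hT) hT (by norm_num)
    (L2A ha Vb) hX hns (by norm_num) (by norm_num) hP V_1.neg le_rfl Vb (by norm_num)
    (by norm_num) V_l
    (by
      have := (D_intC (2)).sub ((D_intC 5).mul V_I.d)
      convert this using 1
      push_cast; grind) (by norm_num) (by norm_num) hR hU with h1 | ⟨k, z, hz, h1⟩
  · have h2 : I * UU t - -1 = 0 := by rw [h1]; ring
    rw [eU] at h2
    have h3 := V_2.ne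
    simp [h3, hI0, hm] at h2
  · rw [eU] at h1
    obtain ⟨i, hi⟩ := exV hm
    have v1 := ((V_2.neg.mul V_I).div hi).sq
    rw [h1] at v1
    have v2 := (((V_4.mul V_l.sq).div hns).mul (V_4.pow k)).mul hz.v
    have v3 := v1.uniq v2
    have ht : t ≠ 0 := by
      rintro rfl
      have := hi.uniq (by simpa using V_I.neg)
      omega
    obtain ⟨j, hj, -⟩ := rat_v ht
    have hj1 : j ≤ -1 := by
      by_contra hj1
      have := hi.le_of_D ((hj.d.mono (l := 0) (by omega)).sub V_I.d)
      omega
    have ht' := hj.ne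
    have hz0 : E ((1 - I / t : K) ^ 2) := by
      apply E_sq
      convert ((V_I.div hj).d.mono (l := 2) (by omega)).neg using 1
      ring
    have hz00 := hz0.v.ne
    have e0 : (t - I : K) ^ 2 = t ^ 2 * (1 - I / t : K) ^ 2 := by field_simp
    generalize (1 - I / t : K) ^ 2 = z0 at *
    refine no_neg ht (hz1.div (hz0.mul hz)) (m := -3 - k) ?_
    have hz10 := hz1.v.ne
    have hzz := hz.v.ne
    have h40 := V_4.ne
    rw [zpow_sub₀ h40, zpow_natCast]
    rw [div_pow, e0] at h1
    generalize z1 = z1 at *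
    have hl' : (1 + I) ^ 2 = 2 * I := hl2
    rw [hl'] at h1
    field_simp at h1 ⊢
    norm_num
    linear_combination -(1 / 2) * h1 + z1 * hI

theorem Cl (t : ℚ) (Y : K) (h : Y ^ 2 = (l * UU t) ^ 3 + 3 * l * (l * UU t) ^ 2 + (2 * l) * (l * UU t)) : t = 1 := by
  have hI' := hI
  have hI0 := V_I.ne
  have hl0 := V_l.ne
  have Vb : V 3 (2 * l) := V_2.mul V_l
  have hb := Vb.ne
  have hd : (3 * l) ^ 2 - 4 * (2 * l) ≠ 0 := by
    have : (3 * l) ^ 2 - 4 * (2 * l) = 2 * I * (5 + 4 * I) := by unfold l; grind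
    rw [this]; exact ((V_2.mul V_I).mul V_pz).ne
  obtain ⟨P, hP⟩ := mk_At hb hd (x := -l) (y := 2 * I) (by unfold l; grind)
  obtain ⟨T, hT⟩ := mk_At hb hd (x := 0) (y := 0) (by ring)
  obtain ⟨R, hR⟩ := mk_At hb hd h
  have hz1 : E (-((-98 + 219 * I) / 29 : K) ^ 2) := by
    apply E_negsq
    have := D_frac (-49) 95 29 (by norm_num)
    convert this using 1
    push_cast; ring
  obtain ⟨Ys, hX⟩ := quad (x2 := -1 / 4) (y2 := 1 / 4 - 5 / 8 * I) (w := I / 2)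
    (w4 := 49 / 58 - 219 / 116 * I) hP (mul_ne_zero V_2.ne hI0)
    (by
      have := (V_unit 2 (-5) (by norm_num)).ne
      intro h; apply this; push_cast; linear_combination 8 * h)
    (by unfold l; grind) (by grind) (by unfold l; grind) (by unfold l; grind)
  set z1 := (-((-98 + 219 * I) / 29 : K) ^ 2) with hz1d
  have hXs : (49 / 58 - 219 / 116 * I) ^ 2 = -z1 / 16 := by
    rw [hz1d]; grind
  rw [hXs] at hX
  have hns : V (-8) (-z1 / 16) := by
    have := hz1.v.neg.div (V_4.pow 2)
    norm_num at this; exact this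
  have hU := V_l.mul (V_UU t)
  have ha : V 1 (3 * l) := by simpa using V_3.mul V_l
  obtain ⟨hp, hm⟩ := t_ne t
  have eU : l * UU t - -l = 2 * I * ((t - 1 : ℚ) : K) / (t - I) := by
    unfold UU l; push_cast; field_simp; grind
  rcases G (c := 4) (e := 1) (f := 3) (g := 2) (h := 2) (ha.d.mono (by norm_num)) (Vb.d.mono (by norm_num)) (MWl hP hT) hT (by norm_num)
    (L2B ha Vb) hX hns (by norm_num) (by norm_num) hP V_l.neg (by norm_num) Vb (by norm_num)
    (by norm_num) (by simpa using V_2.mul V_I)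
    (by
      have := D_frac 1 (-2) 1 (by norm_num)
      convert this using 1
      unfold l
      push_cast; grind) (by norm_num) (by norm_num) hR hU with h1 | ⟨k, z, hz, h1⟩
  · have h2 : l * UU t - -l = 0 := by rw [h1]; ring
    rw [eU] at h2
    have h3 := V_2.ne
    have : ((t - 1 : ℚ) : K) = 0 := by
      rcases div_eq_zero_iff.1 h2 with h4 | h4
      · rcases mul_eq_zero.1 h4 with h5 | h5
        · exact absurd h5 (mul_ne_zero h3 hI0)
        · exact h5
      · exact absurd h4 hm
    have : t - 1 = 0 := by exact_mod_cast this
    linarith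
  · by_contra ht
    have ht' : t - 1 ≠ 0 := sub_ne_zero.2 ht
    obtain ⟨j, hj, -⟩ := rat_v ht'
    obtain ⟨i, hi⟩ := exV hm
    rw [eU] at h1
    have v1 := (((V_2.mul V_I).mul hj).div hi).sq
    rw [h1] at v1
    have v2 := (((V_4.mul (V_2.mul V_I).sq).div hns).mul (V_4.pow k)).mul hz.v
    have v3 := v1.uniq v2
    have e0 : (t - I : K) = (1 - I) + ((t - 1 : ℚ) : K) := by push_cast; ring
    rw [e0] at hi
    have hj1 : 1 ≤ j := by
      by_contra hj1
      have := hi.le_of_D ((V_1mI.d.mono (l := 2 * j) (by omega)).add hj.d)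
      omega
    have := hi.uniq (V_1mI.addD hj.d (by omega))
    omega
end
end N3M3

namespace N3M3
noncomputable section

def ii : ZI := ⟨0, 1⟩
theorem hii : ii ^ 2 = -1 := by
  rw [sq]; ext <;> simp [ii]
theorem lam_eq : lam = 1 + ii := by ext <;> simp [lam, ii]
theorem ii_map : algebraMap ZI K ii = I := rfl

theorem p_two {p : ZI} (hp : Prime p) (h : p ∣ 2) : p ∣ lam := by
  have : (2 : ZI) = -ii * lam ^ 2 := by rw [lam_eq]; linear_combination (2 + ii) * hii
  rw [this] at h
  rcases hp.dvd_or_dvd h with h1 | h1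
  · exfalso
    apply hp.not_isUnit
    apply isUnit_of_dvd_unit h1
    exact IsUnit.of_mul_eq_one ii (by linear_combination -hii)
  · exact hp.dvd_of_dvd_pow h1

def AA (X Z : ZI) : ZI := X ^ 2 + ii * X * Z + (1 + ii) * Z ^ 2
def AB (X Z : ZI) : ZI := X ^ 2 - ii * X * Z + (1 - ii) * Z ^ 2
def QQ (X Z : ZI) : ZI := (X + Z) ^ 2 + Z ^ 2

theorem primes_d {X Z p : ZI} (hc : IsCoprime X Z) (hp : Prime p) (h1 : p ∣ AA X Z * QQ X Z)
    (h2 : p ∣ AB X Z) : p ∣ lam := by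
  have hi := hii
  by_contra hl
  have n2 : ¬ p ∣ 2 := fun h => hl (p_two hp h)
  have ni : ¬ p ∣ ii := by
    intro h
    exact hl ((h.trans (show ii ∣ 1 from ⟨-ii, by linear_combination hii⟩)).trans (one_dvd _))
  have nXZ : p ∣ Z → p ∣ X → False := by
    intro hz hx
    exact hp.not_isUnit (hc.isUnit_of_dvd' hx hz)
  have nZ : ¬ p ∣ Z := by
    intro hz
    apply nXZ hz
    apply hp.dvd_of_dvd_pow (n := 2)
    have : X ^ 2 = AB X Z + Z * (ii * X - (1 - ii) * Z) := by unfold AB; ring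
    rw [this]
    exact dvd_add h2 (hz.mul_right _)
  have two_of {u : ZI} (hu : u ∣ 2 * lam) (h : p ∣ u * Z ^ 2) : False := by
    rcases hp.dvd_or_dvd h with h3 | h3
    · rcases hp.dvd_or_dvd (h3.trans hu) with h4 | h4
      · exact n2 h4
      · exact hl h4
    · exact nZ (hp.dvd_of_dvd_pow h3)
  rcases hp.dvd_or_dvd h1 with h3 | h3
  · have e1 : p ∣ 2 * ii * (Z * (X + Z)) := by
      have := dvd_sub h3 h2
      convert this using 1
      unfold AA AB; ring
    have e2 : p ∣ 2 * (X ^ 2 + Z ^ 2) := by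
      have := dvd_add h3 h2
      convert this using 1
      unfold AA AB; ring
    have e3 : p ∣ X + Z := by
      rcases hp.dvd_or_dvd e1 with h4 | h4
      · rcases hp.dvd_or_dvd h4 with h5 | h5
        · exact absurd h5 n2
        · exact absurd h5 ni
      · rcases hp.dvd_or_dvd h4 with h5 | h5
        · exact absurd h5 nZ
        · exact h5
    have e4 : p ∣ X ^ 2 + Z ^ 2 := (hp.dvd_or_dvd e2).resolve_left n2
    apply two_of (u := 2) (Dvd.intro _ rfl)
    have := dvd_sub e4 (e3.mul_right (X - Z))
    convert this using 1
    ring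
  · have e : QQ X Z = (X + Z + ii * Z) * (X + Z - ii * Z) := by
      unfold QQ; linear_combination (Z ^ 2) * hii
    rw [e] at h3
    rcases hp.dvd_or_dvd h3 with h4 | h4
    · have d1 : 2 * ii ∣ 2 * lam := mul_dvd_mul_left _ ⟨-ii * lam, by linear_combination lam * hii⟩
      refine two_of d1 ?_
      have := dvd_sub h2 (h4.mul_right (X - (1 + 2 * ii) * Z))
      have e2 : AB X Z - (X + Z + ii * Z) * (X - (1 + 2 * ii) * Z) = 2 * ii * Z ^ 2 := by
        unfold AB; linear_combination (2 * Z ^ 2) * hii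
      rwa [e2] at this
    · have d1 : 2 * (1 - ii) ∣ 2 * lam := mul_dvd_mul_left _ ⟨ii, by rw [lam_eq]; linear_combination hii⟩
      refine two_of d1 ?_
      have := dvd_sub h2 (h4.mul_right (X - Z))
      have e2 : AB X Z - (X + Z - ii * Z) * (X - Z) = 2 * (1 - ii) * Z ^ 2 := by
        unfold AB; ring
      rwa [e2] at this

theorem Cls.I {X : K} (h : Cls X) : Cls (I * X) := by
  obtain ⟨r, hr, h⟩ := h
  have hI' := hI
  have hI0 := V_I.ne
  rcases h with h | h | h | h <;> rw [h]
  · exact ⟨r, hr, by right; left; rfl⟩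
  · exact ⟨N3M3.I * r, mul_ne_zero hI0 hr, by left; ring⟩
  · exact ⟨r, hr, by right; right; right; ring⟩
  · exact ⟨N3M3.I * r, mul_ne_zero hI0 hr, by right; right; left; ring⟩

theorem clsM {X Z Y : ZI} (hc : IsCoprime X Z) (hM : AA X Z * QQ X Z ≠ 0)
    (h : (AA X Z * QQ X Z) * AB X Z = Y ^ 2) :
    Cls (-2 * algebraMap ZI K (AA X Z * QQ X Z)) := by
  obtain ⟨d, r, h1, h2, h3⟩ := CL _ _ _ h hM
  have hd : d ≠ 0 := by rintro rfl; simp at h3; exact hM (by simpa using h3)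
  have hr : r ≠ 0 := by rintro rfl; simp at h3; exact hM (by simpa using h3)
  obtain ⟨u, n, hu, e⟩ := cls_of_primes d hd (fun p hp hpd => primes_d hc hp (hpd.trans h1) (hpd.trans h2))
  have c1 := cls_unit_pow u hu n
  rw [← e] at c1
  have hr' : algebraMap ZI K r ≠ 0 := by simpa using hr
  have c2 := ((c1.mulsq hr').mulsq V_l.ne).I
  convert c2 using 1
  rw [h3, map_mul, map_pow, hl2]
  linear_combination (-2 * (algebraMap ZI K) d * (algebraMap ZI K) r ^ 2) * hI
end
end N3M3

namespace N3M3
noncomputable section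

theorem excl_local (x w : ℚ) (r : K) (hq : x ^ 2 + 2 * x + 2 = 2 * w ^ 2)
    (hA : (x : K) ^ 2 + I * x + 1 + I = I * l * r ^ 2) : False := by
  have hw : w ≠ 0 := by
    rintro rfl
    nlinarith [sq_nonneg (x + 1)]
  obtain ⟨jw, hjw, -⟩ := rat_v hw
  have hqK : (x : K) ^ 2 + 2 * x + 2 = 2 * (w : K) ^ 2 := by exact_mod_cast congrArg (Rat.cast (K := K)) hq
  have vq := V_2.mul hjw.sq
  rw [← hqK] at vq
  -- x is even
  obtain ⟨x1, rfl⟩ : ∃ x1 : ℚ, x = 2 * x1 := ⟨x / 2, by ring⟩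
  have hx1 : D 0 (x1 : K) := by
    by_cases h0 : x1 = 0
    · subst h0; simpa using D_zero 0
    obtain ⟨j, hj, -⟩ := rat_v h0
    by_contra hcon
    have hj0 : j < 0 := by
      by_contra hj0
      exact hcon (hj.d.mono (by omega))
    have hx : V (2 + 2 * j) (((2 * x1 : ℚ)) : K) := by push_cast; exact V_2.mul hj
    rcases lt_or_ge (2 + 2 * j) 0 with h1 | h1
    · have h2 := (hx.sq.addD (V_2.d.mul hx.d) (by omega)).addD V_2.d (by omega)
      have := h2.uniq vq
      omega
    · have h3 : 2 + 2 * j = 0 := by omega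
      rw [h3] at hx
      have h2 := (hx.sq.addD (V_2.d.mul hx.d) (by omega)).addD V_2.d (by omega)
      have := h2.uniq vq
      omega
  push_cast at hqK hA
  have h22 := V_2.ne
  have hl0 := V_l.ne
  have hwK : 2 * (x1 : K) * (x1 + 1) = (w : K) ^ 2 - 1 := by
    apply mul_left_cancel₀ h22
    linear_combination hqK
  have hAK : 1 + l * x1 - l ^ 3 * x1 ^ 2 = I * r ^ 2 := by
    apply mul_left_cancel₀ hl0
    have : l * (I * r ^ 2) = I * l * r ^ 2 := by ring
    rw [this, ← hA]
    unfold l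
    have := hI
    grind
  have hunit : V 0 (1 + l * x1 - l ^ 3 * (x1 : K) ^ 2) := by
    have := (V_1.addD (V_l.d.mul hx1) (by norm_num)).subD ((V_l.pow 3).d.mul hx1.sq) (by norm_num)
    exact this
  have hr : V 0 r := by
    rw [hAK] at hunit
    have h1 : V 0 (r ^ 2) := by
      have := hunit.div V_I
      have h2 : I * r ^ 2 / I = r ^ 2 := by have := V_I.ne; field_simp
      rw [h2] at this
      simpa using this
    obtain ⟨i, hi, hr⟩ := V_sq_even h1
    have : i = 0 := by omega
    rwa [this] at hr
  rcases hx1.split with h1 | h1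
  · -- x1 even
    have h2 : D 2 (r ^ 2 - 1) := hr.unit_sq2
    have h3 := V_I.d.mul h2
    have h4 : D 2 (l * (x1 : K) - l ^ 3 * (x1 : K) ^ 2) := 
      ((V_l.d.mul h1).mono (by norm_num)).sub (((V_l.pow 3).d.mul hx1.sq).mono (by norm_num))
    have h5 := (h3.mono (l := 2) (by norm_num)).sub h4
    have e : I * (r ^ 2 - 1) - (l * (x1 : K) - l ^ 3 * (x1 : K) ^ 2) = 1 - I := by
      linear_combination -hAK
    rw [e] at h5
    have := V_1mI.le_of_D h5
    omega
  · have hu := rat_unit h1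
    have hwu : V 0 (w : K) := by
      have h2 : V 0 ((w : K) ^ 2) := by
        have e : (w : K) ^ 2 = 1 + 2 * (x1 * (x1 + 1)) := by linear_combination -hwK
        rw [e]
        exact V_1.addD (V_2.d.mul (h1.d.mul (h1.d.add V_1.d))) (by norm_num)
      obtain ⟨i, hi, h3⟩ := V_sq_even h2
      have : i = 0 := by omega
      rwa [this] at h3
    have hw6 := (rat_unit hwu).2
    rcases hu.1 with h2 | h2
    · have h3 : V 2 ((x1 : K) + 1) := by
        have := V_2.addD h2 (by norm_num)
        convert this using 1; ring
      have h4 := (V_2.mul h1).mul h3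
      rw [hwK] at h4
      have := h4.le_of_D hw6
      omega
    · have h3 : D 4 (I * r ^ 2 - (2 - 3 * I)) := by
        have e : I * r ^ 2 - (2 - 3 * I) = ((x1 : K) + 1) * (l - l ^ 3 * (x1 - 1)) := by
          rw [← hAK]; unfold l
          have := hI
          grind
        rw [e]
        have h5 : D 0 (l - l ^ 3 * ((x1 : K) - 1)) :=
          (V_l.d.mono (by norm_num)).sub (((V_l.pow 3).d.mul (h1.d.sub V_1.d)).mono (by norm_num))
        simpa using h2.mul h5
      rcases hr.unit_sq with h4 | h4
      · have h5 := h3.sub ((V_I.d.mul h4).mono (l := 4) (by norm_num))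
        have e : I * r ^ 2 - (2 - 3 * I) - I * (r ^ 2 - 1) = -2 + 4 * I := by ring
        rw [e] at h5
        have := (V_2.neg.addD (V_4.d.mul V_I.d) (by norm_num)).le_of_D h5
        omega
      · have h5 := h3.sub ((V_I.d.mul h4).mono (l := 4) (by norm_num))
        have e : I * r ^ 2 - (2 - 3 * I) - I * (r ^ 2 + 1) = -(2 * (1 - I)) := by ring
        rw [e] at h5
        have := (V_2.mul V_1mI).neg.le_of_D h5
        omega

theorem norm_AAQQ (X Z : ℤ) : (AA X Z * QQ X Z).norm =
    ((X + Z) ^ 2 + Z ^ 2) * (((X + Z) ^ 2 + Z ^ 2) * (X ^ 4 + 3 * X ^ 2 * Z ^ 2 + 2 * X * Z ^ 3 + 2 * Z ^ 4)) := by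
  have h1 : AA X Z = ⟨X ^ 2 + Z ^ 2, X * Z + Z ^ 2⟩ := by
    unfold AA ii; ext <;> simp [sq]
  have h2 : QQ X Z = (((X + Z) ^ 2 + Z ^ 2 : ℤ) : ZI) := by unfold QQ; push_cast; rfl
  rw [Zsqrtd.norm_mul, h1, h2, Zsqrtd.norm_intCast, Zsqrtd.norm_def]
  ring

theorem excl (X Z Y : ℤ) (hZ : Z ≠ 0) (hY : Y ^ 2 = ((X + Z) ^ 2 + Z ^ 2) *
      (X ^ 4 + 3 * X ^ 2 * Z ^ 2 + 2 * X * Z ^ 3 + 2 * Z ^ 4)) (hY0 : Y ≠ 0) (r : K)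
    (h : -2 * algebraMap ZI K (AA X Z * QQ X Z) = I * l * r ^ 2) : False := by
  obtain ⟨a, b, hb, rfl⟩ := IsFractionRing.div_surjective (A := ZI) r
  have hb0 : b ≠ 0 := nonZeroDivisors.ne_zero hb
  have hbK : algebraMap ZI K b ≠ 0 := by simpa using hb0
  have h2 : -2 * (AA X Z * QQ X Z) * b ^ 2 = ii * lam * a ^ 2 := by
    apply IsFractionRing.injective ZI K
    simp only [map_mul, map_pow, map_neg, map_ofNat, lam_map, ii_map] at h ⊢
    rw [h]; field_simp
  have h3 := congrArg Zsqrtd.norm h2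
  have n2 : (-2 : ZI).norm = 4 := by
    rw [show (-2 : ZI) = ((-2 : ℤ) : ZI) by norm_num, Zsqrtd.norm_intCast]; norm_num
  have nl : (ii * lam).norm = 2 := by
    rw [Zsqrtd.norm_mul]; simp [ii, lam, Zsqrtd.norm_def]
  rw [Zsqrtd.norm_mul, Zsqrtd.norm_mul, Zsqrtd.norm_mul (ii * lam), n2, nl, sq b, sq a, Zsqrtd.norm_mul b,
    Zsqrtd.norm_mul a, norm_AAQQ, ← hY] at h3
  have hnb : b.norm ≠ 0 := by
    intro h0
    exact hb0 (GaussianInt.norm_eq_zero.1 h0)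
  have hZQ : (Z : ℚ) ≠ 0 := by exact_mod_cast hZ
  have hYQ : (Y : ℚ) ≠ 0 := by exact_mod_cast hY0
  have hnbQ : (b.norm : ℚ) ≠ 0 := by exact_mod_cast hnb
  have h3Q : (4:ℚ) * ((((X:ℚ) + Z) ^ 2 + Z ^ 2) * Y ^ 2) * (b.norm * b.norm) = 2 * (a.norm * a.norm) := by
    exact_mod_cast congrArg (Int.cast (R := ℚ)) h3
  have hq : ((X : ℚ) / Z) ^ 2 + 2 * ((X : ℚ) / Z) + 2 = 2 * ((a.norm : ℚ) / (2 * Y * b.norm * Z)) ^ 2 := by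
    field_simp
    linear_combination (1 / 2) * h3Q
  set w : ℚ := (a.norm : ℚ) / (2 * Y * b.norm * Z) with hw
  have hw0 : w ≠ 0 := by
    intro h0
    rw [h0] at hq
    nlinarith [sq_nonneg ((X : ℚ) / Z + 1)]
  have hwK : (w : K) ≠ 0 := by exact_mod_cast hw0
  have hZK : (Z : K) ≠ 0 := by exact_mod_cast hZ
  have hqK : ((X : K) / Z) ^ 2 + 2 * ((X : K) / Z) + 2 = 2 * (w : K) ^ 2 := by
    exact_mod_cast congrArg (Rat.cast (K := K)) hq
  refine excl_local _ w (algebraMap ZI K a / algebraMap ZI K b / (w * (2 * I) * Z ^ 2)) hq ?_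
  have hl0 := V_l.ne
  have e1 : algebraMap ZI K (AA X Z * QQ X Z) =
      (((X : K) / Z) ^ 2 + I * ((X : K) / Z) + 1 + I) * (2 * (w : K) ^ 2) * Z ^ 4 := by
    rw [← hqK]
    unfold AA QQ
    simp only [map_mul, map_pow, map_add, map_one, map_intCast, ii_map]
    field_simp
    ring
  rw [e1] at h
  push_cast
  generalize ((X : K) / Z) ^ 2 + I * ((X : K) / Z) + 1 + I = A at *
  generalize algebraMap ZI K a / algebraMap ZI K b = r at *
  rw [div_pow, mul_div_assoc', ← h]
  have h6 := V_4.ne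
  have h5 : (2 * I) ^ 2 = -4 := by linear_combination 4 * hI
  rw [mul_pow, mul_pow, h5]
  field_simp
  ring
end
end N3M3

namespace N3M3
noncomputable section

theorem curve_id (t : ℚ) : UU t ^ 3 + 3 * UU t ^ 2 + (1 - I) * UU t =
    -2 * (((t : K) ^ 2 + 1) * (((t : K) - 1) ^ 2 + I * (t - 1) + 1 + I)) / ((t - I) ^ 2) ^ 2 := by
  obtain ⟨-, hm⟩ := t_ne t
  have e : UU t * (t - I) = I * (t + I) := by unfold UU; field_simp
  rw [eq_div_iff (pow_ne_zero 2 (pow_ne_zero 2 hm))]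
  have e2 : (UU t ^ 3 + 3 * UU t ^ 2 + (1 - I) * UU t) * ((t - I) ^ 2) ^ 2 =
      ((UU t * (t - I)) ^ 3 + 3 * (UU t * (t - I)) ^ 2 * (t - I) +
        (1 - I) * (UU t * (t - I)) * (t - I) ^ 2) * (t - I) := by ring
  rw [e2, e]
  generalize (t : K) = s
  have := hI
  grind

theorem int_sqrt {w : ℚ} {F : ℤ} (h : w ^ 2 = F) : ∃ c : ℤ, w = c := by
  refine ⟨w.num, ?_⟩
  have h1 : IsIntegral ℤ w := by
    refine IsIntegral.of_pow (n := 2) (by norm_num) ?_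
    rw [h]; exact isIntegral_algebraMap (R := ℤ) (x := F)
  obtain ⟨c, hc⟩ := IsIntegrallyClosed.isIntegral_iff.1 h1
  rw [← hc]; simp

theorem main (x y : ℚ) (h : y ^ 2 = x ^ 6 + 2 * x ^ 5 + 5 * x ^ 4 + 8 * x ^ 3 + 12 * x ^ 2 + 8 * x + 4) :
    x = -1 ∨ x = 0 := by
  have hZ : (x.den : ℤ) ≠ 0 := by exact_mod_cast x.den_ne_zero
  have hcop : IsCoprime x.num (x.den : ℤ) := Rat.isCoprime_num_den x
  have hx : x = (x.num : ℚ) / ((x.den : ℤ) : ℚ) := by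
    push_cast; exact (Rat.num_div_den x).symm
  generalize x.num = X at *
  generalize (x.den : ℤ) = Z at *
  have hZQ : (Z : ℚ) ≠ 0 := by exact_mod_cast hZ
  obtain ⟨Y, hY⟩ := int_sqrt (w := y * Z ^ 3) (F := ((X + Z) ^ 2 + Z ^ 2) *
      (X ^ 4 + 3 * X ^ 2 * Z ^ 2 + 2 * X * Z ^ 3 + 2 * Z ^ 4)) (by
        rw [mul_pow, h, hx]; push_cast; field_simp; ring)
  have hYe : Y ^ 2 = ((X + Z) ^ 2 + Z ^ 2) *
      (X ^ 4 + 3 * X ^ 2 * Z ^ 2 + 2 * X * Z ^ 3 + 2 * Z ^ 4) := by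
    have : (Y : ℚ) ^ 2 = ((X + Z) ^ 2 + Z ^ 2) *
      (X ^ 4 + 3 * X ^ 2 * Z ^ 2 + 2 * X * Z ^ 3 + 2 * Z ^ 4) := by
      rw [← hY, mul_pow, h, hx]; field_simp; ring
    exact_mod_cast this
  have hZ2 : 0 < Z ^ 2 := by positivity
  have p1 : 0 < (X + Z) ^ 2 + Z ^ 2 := by positivity
  have p2 : 0 < X ^ 4 + 3 * X ^ 2 * Z ^ 2 + 2 * X * Z ^ 3 + 2 * Z ^ 4 := by
    have : X ^ 4 + 3 * X ^ 2 * Z ^ 2 + 2 * X * Z ^ 3 + 2 * Z ^ 4 =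
      X ^ 4 + 2 * (X * Z) ^ 2 + (X * Z + Z ^ 2) ^ 2 + (Z ^ 2) ^ 2 := by ring
    rw [this]; positivity
  have hY0 : Y ≠ 0 := by
    rintro rfl
    have := mul_pos p1 p2
    rw [← hYe] at this
    norm_num at this
  have hM : AA X Z * QQ X Z ≠ 0 := by
    intro h0
    have h1 := norm_AAQQ X Z
    rw [h0, Zsqrtd.norm_zero] at h1
    have := mul_pos p1 (mul_pos p1 p2)
    omega
  have hcZ : IsCoprime (X : ZI) (Z : ZI) := by
    have := hcop.map (Int.castRingHom ZI)
    simpa using this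
  have hprod : (AA X Z * QQ X Z) * AB X Z = (Y : ZI) ^ 2 := by
    have e : (Y : ZI) ^ 2 = (((X : ZI) + Z) ^ 2 + Z ^ 2) *
      (X ^ 4 + 3 * X ^ 2 * Z ^ 2 + 2 * X * Z ^ 3 + 2 * Z ^ 4) := by exact_mod_cast congrArg (Int.cast (R := ZI)) hYe
    rw [e]
    have e2 : AA (X : ZI) Z * AB (X : ZI) Z =
        X ^ 4 + 3 * X ^ 2 * Z ^ 2 + 2 * X * Z ^ 3 + 2 * Z ^ 4 := by
      unfold AA AB
      have := hii
      grind
    rw [← e2]; unfold QQ; ring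
  have hZK : (Z : K) ≠ 0 := by exact_mod_cast hZ
  have hid := curve_id (x + 1)
  have eM : -2 * ((((x + 1 : ℚ) : K) ^ 2 + 1) * ((((x + 1 : ℚ) : K) - 1) ^ 2 + I * (((x + 1 : ℚ) : K) - 1) + 1 + I)) =
      -2 * algebraMap ZI K (AA X Z * QQ X Z) / (Z ^ 2) ^ 2 := by
    rw [hx]
    unfold AA QQ
    simp only [map_mul, map_pow, map_add, map_one, map_intCast, ii_map]
    push_cast
    field_simp
    ring
  rw [eM] at hid
  obtain ⟨-, hm⟩ := t_ne (x + 1)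
  obtain ⟨r, hr, h1 | h1 | h1 | h1⟩ := clsM hcZ hM hprod
  · left
    rw [h1] at hid
    have := C1 (x + 1) (r / Z ^ 2 / (((x + 1 : ℚ) : K) - I) ^ 2) (by rw [hid]; field_simp)
    linarith
  · exfalso
    rw [h1] at hid
    refine CI (x + 1) (r / Z ^ 2 / (((x + 1 : ℚ) : K) - I) ^ 2) ?_
    have e : (I * UU (x + 1)) ^ 3 + 3 * I * (I * UU (x + 1)) ^ 2 + (-1 + I) * (I * UU (x + 1)) =
      I ^ 3 * (UU (x + 1) ^ 3 + 3 * UU (x + 1) ^ 2 + (1 - I) * UU (x + 1)) := by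
      have := hI
      grind
    rw [e, hid]
    have e4 : I ^ 4 = 1 := by linear_combination (I ^ 2 - 1) * hI
    have : I ^ 3 * (I * r ^ 2 / (Z ^ 2) ^ 2 / ((((x + 1 : ℚ) : K) - I) ^ 2) ^ 2) =
      I ^ 4 * (r ^ 2 / (Z ^ 2) ^ 2 / ((((x + 1 : ℚ) : K) - I) ^ 2) ^ 2) := by ring
    rw [this, e4]
    field_simp
  · right
    rw [h1] at hid
    have := Cl (x + 1) (l ^ 2 * r / Z ^ 2 / (((x + 1 : ℚ) : K) - I) ^ 2) (by
      have e : (l * UU (x + 1)) ^ 3 + 3 * l * (l * UU (x + 1)) ^ 2 + 2 * l * (l * UU (x + 1)) =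
        l ^ 3 * (UU (x + 1) ^ 3 + 3 * UU (x + 1) ^ 2 + (1 - I) * UU (x + 1)) := by
        have := hI
        have e5 : l * (1 - I) = 2 := by unfold l; linear_combination -hI
        linear_combination (-l ^ 2 * UU (x + 1)) * e5
      rw [e, hid]
      field_simp)
    linarith
  · exact (excl X Z Y hZ hYe hY0 r h1).elim
end
end N3M3

theorem stmt_11 :
    {p : ℚ × ℚ | p.2 ^ 2 = p.1 ^ 6 + 2 * p.1 ^ 5 + 5 * p.1 ^ 4 + 8 * p.1 ^ 3 + 12 * p.1 ^ 2 + 8 * p.1 + 4}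
      = ({(-1, 2), (-1, -2), (0, 2), (0, -2)} : Set (ℚ × ℚ)) := by
  ext ⟨x, y⟩
  simp only [Set.mem_setOf_eq, Set.mem_insert_iff, Set.mem_singleton_iff, Prod.mk.injEq]
  constructor
  · intro h
    rcases N3M3.main x y h with rfl | rfl
    · have : (y - 2) * (y + 2) = 0 := by linear_combination h
      rcases mul_eq_zero.1 this with h1 | h1
      · left; exact ⟨rfl, by linarith⟩
      · right; left; exact ⟨rfl, by linarith⟩
    · have : (y - 2) * (y + 2) = 0 := by linear_combination h
      rcases mul_eq_zero.1 this with h1 | h1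
      · right; right; left; exact ⟨rfl, by linarith⟩
      · right; right; right; exact ⟨rfl, by linarith⟩
  · rintro (⟨rfl, rfl⟩ | ⟨rfl, rfl⟩ | ⟨rfl, rfl⟩ | ⟨rfl, rfl⟩) <;> norm_num
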